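/- arXiv:math/0601433 — 2 statements merged into one kernel-verified Lean document; each statement's English description precedes it below -/
import Mathlib

section
/- (Burago–Kleiner lemma.) Let d ≥ 2 and Iᵈ = [0,1]ᵈ. For every L > 1 and every c > 0, there exists a C^∞ function ρ : ℝᵈ → ℝ with 1 ≤ ρ(x) ≤ 1 + c for all x ∈ Iᵈ, such that there is no map ψ : Iᵈ → ℝᵈ that is L-biLipschitz (i.e. L⁻¹‖x − y‖ ≤ ‖ψ(x) − ψ(y)‖ ≤ L‖x − y‖ for all x, y ∈ Iᵈ) and satisfies the Jacobian equation det Dψ(x) = ρ(x) at almost every x ∈ Iᵈ (that is: for Lebesgue-almost every x ∈ Iᵈ, ψ is differentiable at x and the determinant of its derivative equals ρ(x)). -/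
noncomputable section
open scoped MeasureTheory

/-- The unit cube [0,1]^d. -/
def unitCube (d : ℕ) : Set (EuclideanSpace ℝ (Fin d)) :=
  {x | ∀ i, x i ∈ Set.Icc (0:ℝ) 1}

open MeasureTheory Set Metric Filter Topology
open scoped NNReal Pointwise

section NullLagrangian

variable {V : Type*} [NormedAddCommGroup V] [NormedSpace ℝ V] [FiniteDimensional ℝ V]

lemma exists_abs_det_le (V : Type*) [NormedAddCommGroup V] [NormedSpace ℝ V]
    [FiniteDimensional ℝ V] (K : ℝ) :
    ∃ C : ℝ, 0 < C ∧ ∀ T : V →L[ℝ] V, ‖T‖ ≤ K → |T.det| ≤ C := by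
  obtain ⟨C, hC⟩ := (isCompact_closedBall (0 : V →L[ℝ] V) K).exists_bound_of_continuousOn
    (ContinuousLinearMap.continuous_det (𝕜 := ℝ) (E := V)).continuousOn
  refine ⟨max C 1, by positivity, fun T hT => (hC T ?_).trans (le_max_left _ _)⟩
  simpa using hT

lemma exists_det_one_add_pos (V : Type*) [NormedAddCommGroup V] [NormedSpace ℝ V]
    [FiniteDimensional ℝ V] :
    ∃ η : ℝ, 0 < η ∧ ∀ T : V →L[ℝ] V, ‖T‖ < η → 0 < (1 + T).det := by
  have hcont : Continuous fun T : V →L[ℝ] V => (1 + T).det :=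
    ContinuousLinearMap.continuous_det.comp (continuous_const.add continuous_id)
  have h0 : 0 < (1 + (0 : V →L[ℝ] V)).det := by
    simp [ContinuousLinearMap.det]
  obtain ⟨η, hη, h⟩ := Metric.mem_nhds_iff.1 (hcont.continuousAt.eventually (lt_mem_nhds h0))
  exact ⟨η, hη, fun T hT => h (by simpa using hT)⟩

/-- The determinant of `T` is the top coefficient of the polynomial `a ↦ det (1 + a T)`, hence a
combination of its values at `dim V + 1` nodes. -/
lemma det_eq_sum_det_one_add (s : Finset ℝ) (hs : s.card = Module.finrank ℝ V + 1)
    (T : V →L[ℝ] V) :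
    T.det = ∑ a ∈ s, (1 + a • T).det / ∏ b ∈ s.erase a, (a - b) := by
  let b := Module.finBasis ℝ V
  let A := LinearMap.toMatrix b b (T : V →ₗ[ℝ] V)
  let P := Matrix.det ((Polynomial.X : Polynomial ℝ) • A.map Polynomial.C
    + (1 : Matrix _ _ ℝ).map Polynomial.C)
  have hdeg : P.degree < (s.card : WithBot ℕ) := by
    refine (Polynomial.degree_le_of_natDegree_le
      (Polynomial.natDegree_det_X_add_C_le A 1)).trans_lt ?_
    rw [hs, Fintype.card_fin]
    exact_mod_cast Nat.lt_succ_self _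
  have h := Lagrange.coeff_eq_sum (v := id) (s := s) (Set.injOn_id _) hdeg
  have hcoeff : P.coeff (s.card - 1) = T.det := by
    rw [hs, Nat.add_sub_cancel, ContinuousLinearMap.det, ← LinearMap.det_toMatrix b]
    exact (by simpa only [Fintype.card_fin] using Polynomial.coeff_det_X_add_C_card A 1)
  have heval (a : ℝ) : P.eval a = (1 + a • T).det := by
    rw [ContinuousLinearMap.det, ← LinearMap.det_toMatrix b, ← Polynomial.coe_evalRingHom,
      RingHom.map_det]
    congr 1
    ext i j
    simp [A, LinearMap.toMatrix_apply, Matrix.one_apply, Finsupp.single_apply, add_comm,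
      eq_comm (a := j), apply_ite]
    exact mul_comm _ _
  rw [← hcoeff, h]
  simp [heval]

variable [MeasurableSpace V] [BorelSpace V] (μ : Measure V)

lemma LipschitzWith.integrableOn_det_fderiv {K : ℝ≥0} {f : V → V} (hf : LipschitzWith K f)
    {g : (V →L[ℝ] V) → (V →L[ℝ] V)} (hg : Continuous g) {s : Set V} (hs : μ s ≠ ⊤) :
    IntegrableOn (fun x => (g (fderiv ℝ f x)).det) s μ := by
  have hcont : Continuous fun T => (g T).det := ContinuousLinearMap.continuous_det.comp hg
  obtain ⟨C, hC⟩ := (isCompact_closedBall (0 : V →L[ℝ] V) K).exists_bound_of_continuousOn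
    hcont.continuousOn
  refine Measure.integrableOn_of_bounded (M := C) hs
    (hcont.measurable.comp (measurable_fderiv ℝ f)).aestronglyMeasurable ?_
  refine Eventually.of_forall fun x => hC _ ?_
  simpa using norm_fderiv_le_of_lipschitz ℝ hf

variable [μ.IsAddHaarMeasure]

lemma LipschitzWith.measure_image_eq_zero {K : ℝ≥0} {f : V → V} (hf : LipschitzWith K f)
    {s : Set V} (hs : μ s = 0) : μ (f '' s) = 0 := by
  have hμ : μ = Measure.addHaarScalarFactor μ μH[Module.finrank ℝ V] • μH[Module.finrank ℝ V] :=
    Measure.isAddLeftInvariant_eq_smul _ _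
  have hμ' : μH[Module.finrank ℝ V] =
      Measure.addHaarScalarFactor μH[Module.finrank ℝ V] μ • μ :=
    Measure.isAddLeftInvariant_eq_smul _ _
  have h0 : μH[Module.finrank ℝ V] s = 0 := by
    rw [hμ']; simp [hs]
  have h1 : μH[Module.finrank ℝ V] (f '' s) = 0 := by
    have := hf.hausdorffMeasure_image_le (d := Module.finrank ℝ V) (by positivity) s
    rw [h0, mul_zero] at this
    exact le_antisymm this bot_le
  rw [hμ]; simp [h1]

/-- The area formula for small Lipschitz perturbations of the identity. -/
lemma integral_det_one_add_smul_fderiv {K : ℝ≥0} {f : V → V} (hf : LipschitzWith K f)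
    {η : ℝ} (hη : ∀ T : V →L[ℝ] V, ‖T‖ < η → 0 < (1 + T).det) {a : ℝ} (ha : 0 < a)
    (haη : a * K < η) (ha1 : a * K < 1) {s : Set V} (hs : MeasurableSet s) :
    ∫ x in s, (1 + a • fderiv ℝ f x).det ∂μ = μ.real ((fun x => x + a • f x) '' s) ∧
      Function.Bijective (fun x => x + a • f x) := by
  set F : V → V := fun x => x + a • f x with hF
  have hsub : LipschitzWith (Real.toNNReal a * K) fun x => a • f x := by
    have := (lipschitzWith_smul a (β := V)).comp hf
    rwa [show ‖a‖₊ = Real.toNNReal a from by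
      ext; simp [abs_of_pos ha, ha.le]] at this
  have happrox : ApproximatesLinearOn F
      ((ContinuousLinearEquiv.refl ℝ V : V ≃L[ℝ] V) : V →L[ℝ] V) univ (Real.toNNReal a * K) := by
    rw [ApproximatesLinearOn.approximatesLinearOn_iff_lipschitzOnWith, lipschitzOnWith_univ]
    convert hsub using 1
    ext x; simp [hF]
  have hc : Subsingleton V ∨ Real.toNNReal a * K <
      ‖((ContinuousLinearEquiv.refl ℝ V).symm : V →L[ℝ] V)‖₊⁻¹ := by
    rcases subsingleton_or_nontrivial V with h | h
    · exact Or.inl h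
    · right
      have : ‖((ContinuousLinearEquiv.refl ℝ V).symm : V →L[ℝ] V)‖₊ = 1 := by
        ext; exact ContinuousLinearMap.norm_id
      rw [this, inv_one, ← NNReal.coe_lt_coe]
      simpa [ha.le] using ha1
  have hinj : Function.Injective F := injOn_univ.1 (happrox.injOn hc)
  refine ⟨?_, hinj, happrox.surjective hc⟩
  have hlip : LipschitzWith (1 + Real.toNNReal a * K) F := LipschitzWith.id.add hsub
  set D : Set V := {x | DifferentiableAt ℝ f x}
  have hD : MeasurableSet D := measurableSet_of_differentiableAt ℝ f
  have hDc : μ Dᶜ = 0 := hf.ae_differentiableAt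
  have hderiv : ∀ x ∈ s ∩ D, HasFDerivWithinAt F (1 + a • fderiv ℝ f x) (s ∩ D) x := fun x hx =>
    ((hasFDerivAt_id x).add ((DifferentiableAt.hasFDerivAt hx.2).const_smul a)).hasFDerivWithinAt
  have harea := lintegral_abs_det_fderiv_eq_addHaar_image μ (hs.inter hD) hderiv hinj.injOn
  have himage : μ (F '' (s ∩ D)) = μ (F '' s) := by
    refine le_antisymm (measure_mono (image_mono inter_subset_left)) ?_
    calc μ (F '' s) ≤ μ (F '' (s ∩ D) ∪ F '' Dᶜ) := by
          rw [← image_union]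
          refine measure_mono (image_mono fun x hx => ?_)
          by_cases h : x ∈ D
          · exact Or.inl ⟨hx, h⟩
          · exact Or.inr h
      _ ≤ μ (F '' (s ∩ D)) + μ (F '' Dᶜ) := measure_union_le _ _
      _ = μ (F '' (s ∩ D)) := by rw [hlip.measure_image_eq_zero μ hDc, add_zero]
  have hpos (x : V) : 0 < (1 + a • fderiv ℝ f x).det := by
    refine hη _ ?_
    rw [norm_smul, Real.norm_of_nonneg ha.le]
    exact (mul_le_mul_of_nonneg_left (norm_fderiv_le_of_lipschitz ℝ hf) ha.le).trans_lt haη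
  have hmeas : Measurable fun x => (1 + a • fderiv ℝ f x).det := by
    have hcont : Continuous fun T : V →L[ℝ] V => (1 + a • T).det :=
      ContinuousLinearMap.continuous_det.comp (by fun_prop)
    exact hcont.measurable.comp (measurable_fderiv ℝ f)
  have hrestrict : μ.restrict s = μ.restrict (s ∩ D) := by
    refine Measure.restrict_congr_set ?_
    have : D =ᵐ[μ] univ := eventuallyEq_univ.2 hDc
    simpa using ((ae_eq_refl s).inter this).symm
  rw [hrestrict, integral_eq_lintegral_of_nonneg_ae (Eventually.of_forall fun x => (hpos x).le)
    hmeas.aestronglyMeasurable, Measure.real, ← himage, ← harea]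
  simp only [abs_of_pos (hpos _)]

/-- The Jacobian determinant is a null Lagrangian: its integral depends only on the values of the
map outside the domain of integration. -/
lemma integral_det_fderiv_eq_of_eqOn_compl {K : ℝ≥0} {f g : V → V} (hf : LipschitzWith K f)
    (hg : LipschitzWith K g) {s : Set V} (hs : MeasurableSet s) (hsμ : μ s ≠ ⊤)
    (hfg : EqOn f g sᶜ) :
    ∫ x in s, (fderiv ℝ f x).det ∂μ = ∫ x in s, (fderiv ℝ g x).det ∂μ := by
  obtain ⟨η, hη0, hη⟩ := exists_det_one_add_pos V
  have hKpos : (0 : ℝ) < K + 1 := by positivity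
  set a₀ : ℝ := min η 1 / (K + 1)
  have ha₀ : 0 < a₀ := by positivity
  have hsmall : ∀ a ∈ Ioo 0 a₀, a * K < η ∧ a * K < 1 := by
    intro a ha
    have h1 : a * (K + 1) < min η 1 := (lt_div_iff₀ hKpos).1 ha.2
    have h2 : a * K < min η 1 := by nlinarith [ha.1]
    exact ⟨h2.trans_le (min_le_left _ _), h2.trans_le (min_le_right _ _)⟩
  obtain ⟨t, hts, htc⟩ := (Ioo_infinite ha₀).exists_subset_card_eq (Module.finrank ℝ V + 1)
  have hkey : ∀ a ∈ t, ∫ x in s, (1 + a • fderiv ℝ f x).det ∂μ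
      = ∫ x in s, (1 + a • fderiv ℝ g x).det ∂μ := by
    intro a ha
    have ha' := hts ha
    obtain ⟨h1, h1'⟩ := integral_det_one_add_smul_fderiv μ hf hη ha'.1 (hsmall a ha').1
      (hsmall a ha').2 hs
    obtain ⟨h2, h2'⟩ := integral_det_one_add_smul_fderiv μ hg hη ha'.1 (hsmall a ha').1
      (hsmall a ha').2 hs
    rw [h1, h2]
    congr 1
    rw [← compl_inj_iff, ← image_compl_eq h1', ← image_compl_eq h2']
    exact image_congr fun x hx => by rw [hfg hx]
  have hint {f : V → V} (hf : LipschitzWith K f) (a : ℝ) :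
      Integrable (fun x => (1 + a • fderiv ℝ f x).det) (μ.restrict s) :=
    hf.integrableOn_det_fderiv μ (g := fun T => 1 + a • T) (by fun_prop) hsμ
  have hexp {f : V → V} (hf : LipschitzWith K f) : ∫ x in s, (fderiv ℝ f x).det ∂μ
      = ∑ a ∈ t, (∫ x in s, (1 + a • fderiv ℝ f x).det ∂μ) / ∏ b ∈ t.erase a, (a - b) := by
    simp_rw [det_eq_sum_det_one_add t htc (fderiv ℝ f _)]
    rw [integral_finsetSum _ fun a _ => (hint hf a).div_const _]
    simp_rw [integral_div]
  rw [hexp hf, hexp hg]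
  exact Finset.sum_congr rfl fun a ha => by rw [hkey a ha]

end NullLagrangian

section Compactness

variable {V : Type*} [NormedAddCommGroup V]

lemma eventually_forall_norm_sub_le {ι : Type*} {l : Filter ι} {K : ℝ≥0} {ψ : ι → V → V}
    {φ : V → V} (hψ : ∀ i, LipschitzWith K (ψ i)) (hφ : LipschitzWith K φ)
    (hlim : ∀ x, Tendsto (fun i => ψ i x) l (𝓝 (φ x))) {s : Set V} (hs : IsCompact s)
    {δ : ℝ} (hδ : 0 < δ) : ∀ᶠ i in l, ∀ x ∈ s, ‖ψ i x - φ x‖ ≤ δ := by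
  have he : 0 < δ / (3 * (K + 1)) := by positivity
  obtain ⟨t, -, htfin, hcover⟩ := hs.finite_cover_balls he
  have hev : ∀ᶠ i in l, ∀ y ∈ t, dist (ψ i y) (φ y) < δ / 3 :=
    (htfin.eventually_all).2 fun y _ => (tendsto_order.1
      (tendsto_iff_dist_tendsto_zero.1 (hlim y))).2 _ (by positivity)
  filter_upwards [hev] with i hi x hx
  obtain ⟨y, hy, hxy⟩ := mem_iUnion₂.1 (hcover hx)
  have hK : K * dist x y ≤ δ / 3 := by
    have h1 : dist x y ≤ δ / (3 * (K + 1)) := (mem_ball.1 hxy).le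
    calc K * dist x y ≤ (K + 1) * (δ / (3 * (K + 1))) := by gcongr; simp
      _ = δ / 3 := by field_simp
  rw [← dist_eq_norm]
  calc dist (ψ i x) (φ x) ≤ dist (ψ i x) (ψ i y) + dist (ψ i y) (φ y) + dist (φ y) (φ x) :=
        dist_triangle4 _ _ _ _
    _ ≤ δ / 3 + δ / 3 + δ / 3 := by
        gcongr
        · exact ((hψ i).dist_le_mul x y).trans hK
        · exact (hi y hy).le
        · rw [dist_comm]; exact (hφ.dist_le_mul x y).trans hK
    _ = δ := by ring

variable [NormedSpace ℝ V]

/-- Gluing of two Lipschitz maps that are `δ`-close on a ball, with the transition in a shell of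
width `δ`. -/
lemma exists_lipschitzWith_glue {K : ℝ≥0} {f g : V → V} (hf : LipschitzWith K f)
    (hg : LipschitzWith K g) {q : V} {r δ : ℝ} (hδ : 0 < δ)
    (hclose : ∀ x ∈ closedBall q r, ‖f x - g x‖ ≤ δ) :
    ∃ h : V → V, LipschitzWith (3 * K + 1) h ∧ EqOn h g (closedBall q r)ᶜ ∧
      EqOn h f (ball q (r - δ)) := by
  set χ : V → ℝ := fun x => max 0 (min 1 ((r - dist x q) / δ)) with hχ
  have hχ0 (x : V) : 0 ≤ χ x := le_max_left _ _
  have hχ1 (x : V) : χ x ≤ 1 := max_le zero_le_one (min_le_left _ _)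
  have hχout (x : V) (hx : x ∉ closedBall q r) : χ x = 0 := by
    have : (r - dist x q) / δ ≤ 0 :=
      div_nonpos_of_nonpos_of_nonneg (by simp at hx; linarith) hδ.le
    exact max_eq_left ((min_le_right _ _).trans this)
  have hχin (x : V) (hx : x ∈ ball q (r - δ)) : χ x = 1 := by
    have : 1 ≤ (r - dist x q) / δ := by
      rw [le_div_iff₀ hδ]; simp at hx; linarith
    simp [hχ, min_eq_left this]
  have hχlip (x y : V) : |χ x - χ y| ≤ δ⁻¹ * dist x y := by
    have h1 : |(r - dist x q) / δ - (r - dist y q) / δ| ≤ δ⁻¹ * dist x y := by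
      rw [← sub_div, abs_div, abs_of_pos hδ, div_eq_inv_mul]
      gcongr
      rw [show r - dist x q - (r - dist y q) = dist y q - dist x q by ring, dist_comm x y]
      exact abs_dist_sub_le y x q
    refine le_trans ?_ h1
    refine (abs_max_sub_max_le_max _ _ _ _).trans ?_
    simp only [sub_self, abs_zero]
    refine max_le (abs_nonneg _) ((abs_min_sub_min_le_max _ _ _ _).trans ?_)
    simp
  have hside (x y : V) (hx : x ∈ closedBall q r) :
      ‖χ x • (f x - g x) - χ y • (f y - g y)‖ ≤ (2 * K + 1) * dist x y := by
    have hdiff : ‖(f x - g x) - (f y - g y)‖ ≤ 2 * K * dist x y := by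
      rw [show (f x - g x) - (f y - g y) = (f x - f y) - (g x - g y) by abel]
      refine (norm_sub_le _ _).trans ?_
      rw [← dist_eq_norm, ← dist_eq_norm]
      linarith [hf.dist_le_mul x y, hg.dist_le_mul x y]
    calc ‖χ x • (f x - g x) - χ y • (f y - g y)‖
        = ‖(χ x - χ y) • (f x - g x) + χ y • ((f x - g x) - (f y - g y))‖ := by
          congr 1; module
      _ ≤ |χ x - χ y| * ‖f x - g x‖ + χ y * ‖(f x - g x) - (f y - g y)‖ := by
          refine (norm_add_le _ _).trans ?_
          rw [norm_smul, norm_smul, Real.norm_eq_abs, Real.norm_of_nonneg (hχ0 y)]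
      _ ≤ (δ⁻¹ * dist x y) * δ + 1 * (2 * K * dist x y) := by
          gcongr
          · exact hχlip x y
          · exact hclose x hx
          · exact hχ1 y
      _ = (2 * K + 1) * dist x y := by field_simp; ring
  refine ⟨fun x => g x + χ x • (f x - g x), ?_, fun x hx => ?_, fun x hx => ?_⟩
  · refine LipschitzWith.of_dist_le_mul fun x y => ?_
    have hmain : ‖χ x • (f x - g x) - χ y • (f y - g y)‖ ≤ (2 * K + 1) * dist x y := by
      by_cases hx : x ∈ closedBall q r
      · exact hside x y hx
      by_cases hy : y ∈ closedBall q r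
      · rw [norm_sub_rev, dist_comm]; exact hside y x hy
      · rw [hχout x hx, hχout y hy]; simp; positivity
    rw [dist_eq_norm, show g x + χ x • (f x - g x) - (g y + χ y • (f y - g y))
      = (g x - g y) + (χ x • (f x - g x) - χ y • (f y - g y)) by abel]
    refine (norm_add_le _ _).trans ?_
    have := hg.dist_le_mul x y
    rw [dist_eq_norm (g x)] at this
    push_cast
    linarith
  · simp [hχout x hx]
  · simp [hχin x hx]

variable [FiniteDimensional ℝ V]

lemma exists_tendsto_ultrafilter {ι : Type*} (U : Ultrafilter ι) {K : ℝ≥0} {ψ : ι → V → V}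
    (hψ : ∀ i, LipschitzWith K (ψ i)) (h0 : ∀ i, ψ i 0 = 0) :
    ∃ φ : V → V, LipschitzWith K φ ∧ φ 0 = 0 ∧
      ∀ x, Tendsto (fun i => ψ i x) U (𝓝 (φ x)) := by
  have hex (x : V) : ∃ y, Tendsto (fun i => ψ i x) U (𝓝 y) := by
    have hmem : ∀ i, ψ i x ∈ closedBall (0 : V) (K * ‖x‖) := fun i => by
      simpa [h0] using (hψ i).dist_le_mul x 0
    obtain ⟨y, -, hy⟩ := (isCompact_closedBall (0 : V) (K * ‖x‖)).ultrafilter_le_nhds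
      (U.map fun i => ψ i x) (by
        rw [le_principal_iff]
        exact Ultrafilter.mem_coe.2 (Ultrafilter.mem_map.2 (Eventually.of_forall hmem)))
    exact ⟨y, hy⟩
  choose φ hφ using hex
  refine ⟨φ, LipschitzWith.of_dist_le_mul fun x y => ?_, ?_, hφ⟩
  · exact le_of_tendsto ((hφ x).dist (hφ y)) (Eventually.of_forall fun i => (hψ i).dist_le_mul x y)
  · refine tendsto_nhds_unique (hφ 0) ?_
    simp [h0]

variable [MeasurableSpace V] [BorelSpace V] (μ : Measure V) [μ.IsAddHaarMeasure]

lemma exists_measureReal_shell_le (q : V) {r : ℝ} (hr : 0 < r) {ε : ℝ} (hε : 0 < ε) :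
    ∃ δ, 0 < δ ∧ μ.real (closedBall q r \ ball q (r - δ)) ≤ ε := by
  have hcont : ContinuousAt (fun δ : ℝ => (r ^ Module.finrank ℝ V
      - (r - δ) ^ Module.finrank ℝ V) * μ.real (ball 0 1)) 0 := by fun_prop
  have h0 : (fun δ : ℝ => (r ^ Module.finrank ℝ V
      - (r - δ) ^ Module.finrank ℝ V) * μ.real (ball 0 1)) 0 < ε := by simpa using hε
  have hev : ∀ᶠ δ in 𝓝[>] (0 : ℝ), (r ^ Module.finrank ℝ V
      - (r - δ) ^ Module.finrank ℝ V) * μ.real (ball 0 1) < ε :=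
    (hcont.eventually (gt_mem_nhds h0)).filter_mono nhdsWithin_le_nhds
  obtain ⟨δ, hδε, hδ⟩ := (hev.and (Ioo_mem_nhdsGT hr)).exists
  refine ⟨δ, hδ.1, ?_⟩
  have hpos : 0 < r - δ := by linarith [hδ.2]
  rw [measureReal_sdiff (ball_subset_closedBall.trans (closedBall_subset_closedBall
    (by linarith [hδ.1]))) measurableSet_ball measure_closedBall_lt_top.ne, Measure.addHaar_real_closedBall μ q hr.le,
    measureReal_def, measureReal_def, Measure.addHaar_ball_of_pos μ q hpos, ENNReal.toReal_mul,
    ENNReal.toReal_ofReal (by positivity)]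
  rw [measureReal_def] at hδε
  linarith

lemma tendsto_integral_det_fderiv {ι : Type*} {l : Filter ι} {K : ℝ≥0} {ψ : ι → V → V}
    {φ : V → V} (hψ : ∀ i, LipschitzWith K (ψ i)) (hφ : LipschitzWith K φ)
    (hlim : ∀ x, Tendsto (fun i => ψ i x) l (𝓝 (φ x))) (q : V) {r : ℝ} (hr : 0 < r) :
    Tendsto (fun i => ∫ x in closedBall q r, (fderiv ℝ (ψ i) x).det ∂μ) l
      (𝓝 (∫ x in closedBall q r, (fderiv ℝ φ x).det ∂μ)) := by
  obtain ⟨C, hC0, hC⟩ := exists_abs_det_le V (3 * K + 1)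
  rw [Metric.tendsto_nhds]
  intro ε hε
  obtain ⟨δ, hδ, hshell⟩ := exists_measureReal_shell_le μ q hr
    (show 0 < ε / (4 * C) by positivity)
  filter_upwards [eventually_forall_norm_sub_le hψ hφ hlim (isCompact_closedBall q r) hδ] with i hi
  obtain ⟨h, hlip, hout, hin⟩ := exists_lipschitzWith_glue (hψ i) hφ hδ hi
  have hKle : K ≤ 3 * K + 1 := by
    rw [← NNReal.coe_le_coe]; push_cast; linarith [K.coe_nonneg]
  have hfin : μ (closedBall q r) ≠ ⊤ := measure_closedBall_lt_top.ne
  have hψ' := (hψ i).weaken hKle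
  rw [← integral_det_fderiv_eq_of_eqOn_compl μ hlip (hφ.weaken hKle) measurableSet_closedBall hfin
    hout, Real.dist_eq, ← integral_sub
      (hψ'.integrableOn_det_fderiv μ (g := fun T => T) continuous_id hfin)
      (hlip.integrableOn_det_fderiv μ (g := fun T => T) continuous_id hfin)]
  have hzero : ∀ x ∈ closedBall q r \ (closedBall q r \ ball q (r - δ)),
      (fderiv ℝ (ψ i) x).det - (fderiv ℝ h x).det = 0 := by
    intro x hx
    have hx' : x ∈ ball q (r - δ) := by
      by_contra hcon; exact hx.2 ⟨hx.1, hcon⟩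
    rw [(hin.eventuallyEq_of_mem (isOpen_ball.mem_nhds hx')).fderiv_eq, sub_self]
  have hbound : ∀ x, ‖(fderiv ℝ (ψ i) x).det - (fderiv ℝ h x).det‖ ≤ 2 * C := by
    intro x
    have h1 := hC (fderiv ℝ (ψ i) x) (by
      simpa using norm_fderiv_le_of_lipschitz ℝ hψ' (x₀ := x))
    have h2 := hC (fderiv ℝ h x) (by simpa using norm_fderiv_le_of_lipschitz ℝ hlip (x₀ := x))
    refine (norm_sub_le _ _).trans ?_
    simp only [Real.norm_eq_abs]
    linarith
  rw [setIntegral_eq_of_subset_of_forall_sdiff_eq_zero measurableSet_closedBall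
    sdiff_subset hzero, ← Real.norm_eq_abs]
  calc _ ≤ 2 * C * μ.real (closedBall q r \ ball q (r - δ)) :=
        norm_setIntegral_le_of_norm_le_const
          ((measure_mono sdiff_subset).trans_lt measure_closedBall_lt_top) fun x _ => hbound x
    _ ≤ 2 * C * (ε / (4 * C)) := by gcongr
    _ < ε := by
        rw [show 2 * C * (ε / (4 * C)) = ε / 2 by field_simp; ring]
        linarith

end Compactness

section WeakSolutions

variable {V : Type*} [NormedAddCommGroup V] [NormedSpace ℝ V]

/-- The map `ψ`, zoomed in at `q` with scale `h` and normalised to fix the origin. -/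
def zoom (q : V) (h : ℝ) (ψ : V → V) : V → V := fun x => h⁻¹ • (ψ (q + h • x) - ψ q)

lemma zoom_zero (q : V) (h : ℝ) (ψ : V → V) : zoom q h ψ 0 = 0 := by
  simp [zoom]

lemma lipschitzWith_zoom {K : ℝ≥0} {ψ : V → V} (hψ : LipschitzWith K ψ) (q : V) {h : ℝ}
    (hh : 0 < h) : LipschitzWith K (zoom q h ψ) := by
  refine LipschitzWith.of_dist_le_mul fun x y => ?_
  have h1 := hψ.dist_le_mul (q + h • x) (q + h • y)
  rw [dist_add_left, dist_smul₀, Real.norm_of_nonneg hh.le] at h1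
  rw [zoom, zoom, dist_smul₀, dist_sub_right, Real.norm_of_nonneg (by positivity)]
  calc h⁻¹ * dist (ψ (q + h • x)) (ψ (q + h • y)) ≤ h⁻¹ * (K * (h * dist x y)) := by gcongr
    _ = K * dist x y := by field_simp

lemma fderiv_zoom (q : V) {h : ℝ} (hh : 0 < h) (ψ : V → V) (x : V) :
    fderiv ℝ (zoom q h ψ) x = fderiv ℝ ψ (q + h • x) := by
  have h1 : zoom q h ψ = h⁻¹ • fun x => (fun z => ψ (q + z)) (h • x) - ψ q := rfl
  rw [h1, fderiv_const_smul_field, Pi.smul_apply, fderiv_sub_const,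
    fderiv_comp_smul (f := fun z => ψ (q + z)), fderiv_comp_add_left, smul_smul,
    inv_mul_cancel₀ hh.ne', one_smul]

variable [FiniteDimensional ℝ V] [MeasurableSpace V] [BorelSpace V] (μ : Measure V)
  [μ.IsAddHaarMeasure]

lemma setIntegral_closedBall_comp_affine (F : V → ℝ) (q x : V) {h : ℝ} (hh : 0 < h) (r : ℝ) :
    ∫ y in closedBall x r, F (q + h • y) ∂μ =
      (h ^ Module.finrank ℝ V)⁻¹ * ∫ y in closedBall (q + h • x) (h * r), F y ∂μ := by
  have hball : h • closedBall x r = closedBall (h • x) (h * r) := by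
    rw [_root_.smul_closedBall' hh.ne', Real.norm_of_nonneg hh.le]
  have hpre : closedBall (h • x) (h * r) =
      (fun z => q + z) ⁻¹' closedBall (q + h • x) (h * r) := by
    ext z; simp
  rw [Measure.setIntegral_comp_smul_of_pos μ (fun z => F (q + z)) _ hh, hball, smul_eq_mul, hpre,
    (measurePreserving_add_left μ q).setIntegral_preimage_emb
      (Homeomorph.addLeft q).measurableEmbedding]

lemma integral_det_fderiv_zoom {ψ : V → V} {ρ : V → ℝ} (q x : V) {h : ℝ} (hh : 0 < h) {r : ℝ}
    (heq : ∫ y in closedBall (q + h • x) (h * r), (fderiv ℝ ψ y).det ∂μ =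
      ∫ y in closedBall (q + h • x) (h * r), ρ y ∂μ) :
    ∫ y in closedBall x r, (fderiv ℝ (zoom q h ψ) y).det ∂μ =
      ∫ y in closedBall x r, ρ (q + h • y) ∂μ := by
  simp_rw [fderiv_zoom q hh]
  rw [setIntegral_closedBall_comp_affine μ (fun z => (fderiv ℝ ψ z).det) q x hh, heq,
    setIntegral_closedBall_comp_affine μ ρ q x hh]

/-- `ψ` is `K`-Lipschitz, fixes the origin and has Jacobian determinant `ρ`, in the sense that the
integrals over balls agree. -/
structure IsWeakSolution (K : ℝ≥0) (ρ : V → ℝ) (ψ : V → V) : Prop where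
  lipschitz : LipschitzWith K ψ
  map_zero : ψ 0 = 0
  integral_det : ∀ x r, 0 < r →
    ∫ y in closedBall x r, (fderiv ℝ ψ y).det ∂μ = ∫ y in closedBall x r, ρ y ∂μ

variable {μ} in
/-- Weak solutions are compact under weak convergence of the densities. -/
lemma exists_isWeakSolution_of_tendsto {ι : Type*} (U : Ultrafilter ι) {K : ℝ≥0}
    {ψ : ι → V → V} {σ : ι → V → ℝ} {ρ : V → ℝ} (hψ : ∀ i, LipschitzWith K (ψ i))
    (h0 : ∀ i, ψ i 0 = 0)
    (hint : ∀ x r, 0 < r → ∀ᶠ i in (U : Filter ι),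
      ∫ y in closedBall x r, (fderiv ℝ (ψ i) y).det ∂μ = ∫ y in closedBall x r, σ i y ∂μ)
    (hσ : ∀ x r, 0 < r → Tendsto (fun i => ∫ y in closedBall x r, σ i y ∂μ) U
      (𝓝 (∫ y in closedBall x r, ρ y ∂μ))) :
    ∃ φ, IsWeakSolution μ K ρ φ ∧ ∀ x, Tendsto (fun i => ψ i x) U (𝓝 (φ x)) := by
  obtain ⟨φ, hφ, hφ0, hlim⟩ := exists_tendsto_ultrafilter U hψ h0
  refine ⟨φ, ⟨hφ, hφ0, fun x r hr => ?_⟩, hlim⟩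
  exact tendsto_nhds_unique ((tendsto_integral_det_fderiv μ hψ hφ hlim x hr).congr' (hint x r hr))
    (hσ x r hr)

/-- There are no Lipschitz maps with different Jacobian integrals on a ball and on its translate
by `e` whose increments along `e` are, up to arbitrarily small error, constant. -/
lemma exists_finset_not_almost_constant_increment (K : ℝ≥0) (e : V) {r : ℝ} (hr : 0 < r)
    {a b : ℝ} (hab : a ≠ b) :
    ∃ (F : Finset V) (ε : ℝ), 0 < ε ∧ ∀ g : V → V, LipschitzWith K g → g 0 = 0 →
      ∫ y in closedBall 0 r, (fderiv ℝ g y).det ∂μ = a →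
      ∫ y in closedBall e r, (fderiv ℝ g y).det ∂μ = b →
      ∃ x ∈ F, ε < ‖(g (x + e) - g x) - (g e - g 0)‖ := by
  classical
  by_contra! hcon
  have hcon' (i : Finset V × ℕ) := hcon i.1 (1 / ((i.2 : ℝ) + 1)) (by positivity)
  choose g hg hg0 ha hb hF using hcon'
  let U : Ultrafilter (Finset V × ℕ) := Ultrafilter.of atTop
  have hU : (U : Filter (Finset V × ℕ)) ≤ atTop := Ultrafilter.of_le atTop
  obtain ⟨φ, hφ, -, hlim⟩ := exists_tendsto_ultrafilter U hg hg0
  have hinc (x : V) : φ (x + e) = φ x + (φ e - φ 0) := by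
    have h1 : Tendsto (fun i => ‖(g i (x + e) - g i x) - (g i e - g i 0)‖) U
        (𝓝 ‖(φ (x + e) - φ x) - (φ e - φ 0)‖) :=
      (((hlim _).sub (hlim _)).sub ((hlim _).sub (hlim _))).norm
    have h2 : Tendsto (fun i : Finset V × ℕ => 1 / ((i.2 : ℝ) + 1)) U (𝓝 0) :=
      (tendsto_one_div_add_atTop_nhds_zero_nat.comp
        (tendsto_snd.mono_left prod_atTop_atTop_eq.ge)).mono_left hU
    have h3 : ∀ᶠ i in (U : Filter (Finset V × ℕ)), x ∈ i.1 := by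
      refine hU ?_
      filter_upwards [eventually_ge_atTop (({x} : Finset V), 0)] with i hi
      exact hi.1 (Finset.mem_singleton_self x)
    have h4 := le_of_tendsto_of_tendsto h1 h2 (h3.mono fun i hi => hF i x hi)
    rw [norm_le_zero_iff, sub_eq_zero, sub_eq_iff_eq_add] at h4
    rw [h4, add_comm]
  have hJ0 := tendsto_nhds_unique (tendsto_integral_det_fderiv μ hg hφ hlim 0 hr)
    (by simp only [ha]; exact tendsto_const_nhds)
  have hJe := tendsto_nhds_unique (tendsto_integral_det_fderiv μ hg hφ hlim e hr)
    (by simp only [hb]; exact tendsto_const_nhds)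
  have hD (y : V) : fderiv ℝ φ (e + y) = fderiv ℝ φ y := by
    rw [← fderiv_comp_add_left, show (fun x => φ (e + x)) = fun x => φ x + (φ e - φ 0) from
      funext fun x => by rw [add_comm, hinc], fderiv_add_const]
  have hshift := setIntegral_closedBall_comp_affine μ (fun z => (fderiv ℝ φ z).det) e 0
    one_pos r
  simp only [one_smul, hD, one_pow, inv_one, one_mul, add_zero] at hshift
  exact hab (hJ0.symm.trans (hshift.trans hJe))

end WeakSolutions

section Averaging

variable {V : Type*} [NormedAddCommGroup V] [InnerProductSpace ℝ V]

lemma exists_even_index_norm_sub_sq_le {F : Finset V} {u : ℕ → V → V} {M : V} {A η τ : ℝ} {m : ℕ}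
    (hm : 0 < m) (hu : ∀ i x, ‖u i x‖ ≤ A) (hM : ‖M‖ ≤ A) (hη : A - ‖M‖ ≤ η)
    (hsum : ∀ x ∈ F, ‖∑ i ∈ Finset.range (2 * m), u i x - (2 * m : ℝ) • M‖ ≤ 2 * m * τ) :
    ∃ i < m, ∀ x ∈ F, ‖u (2 * i) x - M‖ ^ 2 ≤ 2 * F.card * (2 * A * (η + τ)) := by
  have hA : 0 ≤ A := (norm_nonneg _).trans hM
  have hm' : (0 : ℝ) < m := by exact_mod_cast hm
  have hx : ∀ x ∈ F, ∑ i ∈ Finset.range (2 * m), ‖u i x - M‖ ^ 2 ≤ 2 * m * (2 * A * (η + τ)) := by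
    intro x hx
    have hinner : -(A * (2 * m * τ)) ≤
        inner ℝ (∑ i ∈ Finset.range (2 * m), u i x - (2 * m : ℝ) • M) M := by
      have h1 := (abs_le.1 (abs_real_inner_le_norm
        (∑ i ∈ Finset.range (2 * m), u i x - (2 * m : ℝ) • M) M)).1
      have h2 : ‖∑ i ∈ Finset.range (2 * m), u i x - (2 * m : ℝ) • M‖ * ‖M‖ ≤ (2 * m * τ) * A :=
        mul_le_mul (hsum x hx) hM (norm_nonneg _) ((norm_nonneg _).trans (hsum x hx))
      linarith
    rw [inner_sub_left, inner_smul_left, real_inner_self_eq_norm_sq] at hinner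
    simp only [conj_trivial] at hinner
    have hexpand : ∑ i ∈ Finset.range (2 * m), ‖u i x - M‖ ^ 2 =
        ∑ i ∈ Finset.range (2 * m), ‖u i x‖ ^ 2
          - 2 * inner ℝ (∑ i ∈ Finset.range (2 * m), u i x) M + 2 * m * ‖M‖ ^ 2 := by
      simp_rw [norm_sub_sq_real, Finset.sum_add_distrib, Finset.sum_sub_distrib, sum_inner,
        Finset.mul_sum]
      simp
    have hsq : ∑ i ∈ Finset.range (2 * m), ‖u i x‖ ^ 2 ≤ 2 * m * A ^ 2 := by
      calc ∑ i ∈ Finset.range (2 * m), ‖u i x‖ ^ 2 ≤ ∑ i ∈ Finset.range (2 * m), A ^ 2 := by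
            gcongr with i _; exact hu i x
        _ = 2 * m * A ^ 2 := by simp
    have hMA : A ^ 2 - ‖M‖ ^ 2 ≤ 2 * A * η := by
      nlinarith [norm_nonneg M]
    rw [hexpand]
    nlinarith
  have htotal : ∑ i ∈ Finset.range m, ∑ x ∈ F, ‖u (2 * i) x - M‖ ^ 2 ≤
      ∑ _i ∈ Finset.range m, 2 * F.card * (2 * A * (η + τ)) := by
    rw [Finset.sum_comm]
    calc ∑ x ∈ F, ∑ i ∈ Finset.range m, ‖u (2 * i) x - M‖ ^ 2
        ≤ ∑ x ∈ F, ∑ i ∈ Finset.range (2 * m), ‖u i x - M‖ ^ 2 := by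
          refine Finset.sum_le_sum fun x _ => ?_
          rw [← Finset.sum_image (s := Finset.range m) (g := fun i => 2 * i)
            (f := fun i => ‖u i x - M‖ ^ 2) (fun i _ j _ h => by simpa using h)]
          refine Finset.sum_le_sum_of_subset_of_nonneg ?_ fun _ _ _ => by positivity
          intro j hj
          simp only [Finset.mem_image, Finset.mem_range] at hj ⊢
          omega
      _ ≤ ∑ _x ∈ F, 2 * m * (2 * A * (η + τ)) := Finset.sum_le_sum hx
      _ = ∑ _i ∈ Finset.range m, 2 * F.card * (2 * A * (η + τ)) := by simp; ring
  obtain ⟨i, hi, hle⟩ := Finset.exists_le_of_sum_le (Finset.nonempty_range_iff.2 hm.ne') htotal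
  refine ⟨i, Finset.mem_range.1 hi, fun x hxF => le_trans ?_ hle⟩
  exact Finset.single_le_sum (f := fun x => ‖u (2 * i) x - M‖ ^ 2) (fun _ _ => by positivity) hxF

/-- If a segment in direction `e` is stretched almost as much as the map allows in that direction,
then the zoom of the map at some even subdivision point of the segment has almost constant
increments along `e`. -/
lemma exists_zoom_almost_constant_increment {K : ℝ≥0} {ψ : V → V} (hψ : LipschitzWith K ψ)
    {e p : V} {A η h R ε : ℝ} {m : ℕ} (hm : 0 < m) (hh : 0 < h)
    (hA : ∀ x t, 0 ≤ t → ‖ψ (x + t • e) - ψ x‖ ≤ A * t)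
    (hstretch : (A - η) * (2 * m * h) ≤ ‖ψ (p + (2 * m * h) • e) - ψ p‖)
    (F : Finset V) (hR : 0 ≤ R) (hF : ∀ x ∈ F, ‖x‖ ≤ R) (hε : 0 ≤ ε)
    (hsmall : 2 * (F.card + 1) * (2 * A * (η + K * R / m)) ≤ (ε / 2) ^ 2) :
    ∃ i < m, ∀ x ∈ F, ‖(zoom (p + (2 * i * h) • e) h ψ (x + e) - zoom (p + (2 * i * h) • e) h ψ x)
      - (zoom (p + (2 * i * h) • e) h ψ e - zoom (p + (2 * i * h) • e) h ψ 0)‖ ≤ ε := by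
  classical
  have hm' : (0 : ℝ) < m := by exact_mod_cast hm
  set f : V → ℕ → V := fun x i => h⁻¹ • ψ (p + (i * h) • e + h • x) with hf
  set u : ℕ → V → V := fun i x => f x (i + 1) - f x i with hu_def
  set M : V := (2 * m : ℝ)⁻¹ • (f 0 (2 * m) - f 0 0) with hM_def
  have hfsub (x y : V) (i : ℕ) : ‖f x i - f y i‖ ≤ K * ‖x - y‖ := by
    simp only [hf]
    rw [← smul_sub, norm_smul, Real.norm_of_nonneg (by positivity), ← dist_eq_norm]
    have h1 := hψ.dist_le_mul (p + (i * h) • e + h • x) (p + (i * h) • e + h • y)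
    rw [dist_add_left, dist_smul₀, Real.norm_of_nonneg hh.le, dist_eq_norm x y] at h1
    calc _ ≤ h⁻¹ * (K * (h * ‖x - y‖)) := by gcongr
      _ = K * ‖x - y‖ := by field_simp
  have hu (i : ℕ) (x : V) : ‖u i x‖ ≤ A := by
    have h1 := hA (p + (i * h) • e + h • x) h hh.le
    have h2 : u i x = h⁻¹ • (ψ (p + (i * h) • e + h • x + h • e)
        - ψ (p + (i * h) • e + h • x)) := by
      simp only [hu_def, hf]
      rw [← smul_sub]
      congr 3
      push_cast
      module
    rw [h2, norm_smul, Real.norm_of_nonneg (by positivity)]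
    calc _ ≤ h⁻¹ * (A * h) := by gcongr
      _ = A := by field_simp
  have hMnorm : ‖M‖ = ‖ψ (p + (2 * m * h) • e) - ψ p‖ / (2 * m * h) := by
    simp only [hM_def, hf]
    rw [← smul_sub, smul_smul, norm_smul, Real.norm_of_nonneg (by positivity)]
    push_cast
    simp only [smul_zero, add_zero, zero_mul, zero_smul]
    field_simp
  have hM : ‖M‖ ≤ A := by
    rw [hMnorm, div_le_iff₀ (by positivity)]
    exact hA _ _ (by positivity)
  have hη : A - ‖M‖ ≤ η := by
    have : A - η ≤ ‖M‖ := by rwa [hMnorm, le_div_iff₀ (by positivity)]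
    linarith
  have hsum : ∀ x ∈ insert 0 F, ‖∑ i ∈ Finset.range (2 * m), u i x - (2 * m : ℝ) • M‖
      ≤ 2 * m * (K * R / m) := by
    intro x hx
    have hxR : ‖x‖ ≤ R := by
      rcases Finset.mem_insert.1 hx with rfl | hx
      · simpa using hR
      · exact hF x hx
    have hK : K * ‖x - 0‖ ≤ K * R := by rw [sub_zero]; gcongr
    rw [hu_def, Finset.sum_range_sub (f x), hM_def, smul_smul, mul_inv_cancel₀ (by positivity),
      one_smul, show f x (2 * m) - f x 0 - (f 0 (2 * m) - f 0 0)
        = (f x (2 * m) - f 0 (2 * m)) - (f x 0 - f 0 0) by abel]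
    calc _ ≤ K * R + K * R := (norm_sub_le _ _).trans
            (add_le_add ((hfsub _ _ _).trans hK) ((hfsub _ _ _).trans hK))
      _ = _ := by field_simp; ring
  obtain ⟨i, hi, hgood⟩ := exists_even_index_norm_sub_sq_le hm hu hM hη hsum
  have hclose : ∀ x ∈ insert 0 F, ‖u (2 * i) x - M‖ ≤ ε / 2 := by
    intro x hx
    refine le_of_sq_le_sq ?_ (by positivity)
    have hβ : 0 ≤ 2 * A * (η + K * R / m) := by
      have h1 : 0 ≤ A := (norm_nonneg _).trans hM
      have h2 : 0 ≤ η := by linarith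
      positivity
    have hcard : ((insert 0 F).card : ℝ) ≤ F.card + 1 := by
      exact_mod_cast Finset.card_insert_le 0 F
    exact (hgood x hx).trans (le_trans (by gcongr) hsmall)
  have hzoom (x : V) : zoom (p + (2 * i * h) • e) h ψ (x + e)
      - zoom (p + (2 * i * h) • e) h ψ x = u (2 * i) x := by
    simp only [zoom, hu_def, hf]
    rw [← smul_sub, ← smul_sub, sub_sub_sub_cancel_right]
    push_cast
    congr 3
    module
  refine ⟨i, hi, fun x hx => ?_⟩
  have hzoom0 := hzoom 0
  rw [zero_add] at hzoom0
  rw [hzoom, hzoom0, show u (2 * i) x - u (2 * i) 0 = (u (2 * i) x - M) - (u (2 * i) 0 - M) by abel]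
  refine (norm_sub_le _ _).trans ?_
  linarith [hclose x (Finset.mem_insert_of_mem hx), hclose 0 (Finset.mem_insert_self _ _)]

end Averaging

section Globalization

variable {d : ℕ}

/-- The centre of the unit cube. -/
def cubeCenter (d : ℕ) : EuclideanSpace ℝ (Fin d) := WithLp.toLp 2 fun _ => 1 / 2

lemma closedBall_cubeCenter_subset : closedBall (cubeCenter d) (1 / 2) ⊆ unitCube d := by
  intro x hx i
  have h1 := (PiLp.norm_apply_le (x - cubeCenter d) i).trans (mem_closedBall_iff_norm.1 hx)
  rw [Real.norm_eq_abs, abs_le] at h1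
  simp only [PiLp.sub_apply, cubeCenter] at h1
  constructor <;> linarith [h1.1, h1.2]

/-- A Lipschitz map on the cube with Jacobian determinant `ρ` extends to a Lipschitz map with the
right Jacobian integrals over the balls contained in the ball inscribed in the cube. -/
lemma exists_lipschitzWith_integral_det_eq {K : ℝ≥0}
    {ψ : EuclideanSpace ℝ (Fin d) → EuclideanSpace ℝ (Fin d)} {ρ : EuclideanSpace ℝ (Fin d) → ℝ}
    (hψ : LipschitzOnWith K ψ (unitCube d))
    (hdet : ∀ᵐ x ∂(volume.restrict (unitCube d)),
      ∃ D : EuclideanSpace ℝ (Fin d) →L[ℝ] EuclideanSpace ℝ (Fin d),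
        HasFDerivWithinAt ψ D (unitCube d) x ∧ LinearMap.det D.toLinearMap = ρ x) :
    ∃ φ, LipschitzWith (lipschitzExtensionConstant (EuclideanSpace ℝ (Fin d)) * K) φ ∧
      ∀ s ⊆ ball (cubeCenter d) (1 / 2),
        ∫ y in s, (fderiv ℝ φ y).det = ∫ y in s, ρ y := by
  obtain ⟨φ, hφ, heq⟩ := hψ.extend_finite_dimension
  refine ⟨φ, hφ, fun s hs => integral_congr_ae ?_⟩
  have hsub : ball (cubeCenter d) (1 / 2) ⊆ unitCube d :=
    ball_subset_closedBall.trans closedBall_cubeCenter_subset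
  have h1 : ∀ᵐ x ∂(volume.restrict (ball (cubeCenter d) (1 / 2))),
      (fderiv ℝ φ x).det = ρ x := by
    filter_upwards [ae_restrict_of_ae_restrict_of_subset hsub hdet,
      ae_restrict_mem measurableSet_ball] with x ⟨D, hD, hDρ⟩ hx
    have hnhds : unitCube d ∈ 𝓝 x := mem_of_superset (isOpen_ball.mem_nhds hx) hsub
    have h2 : HasFDerivAt φ D x :=
      (hD.congr (fun y hy => (heq hy).symm) (heq (hsub hx)).symm).hasFDerivAt hnhds
    rw [h2.fderiv, ← hDρ]
  exact ae_restrict_of_ae_restrict_of_subset hs h1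

/-- If the Jacobian equation is solvable on the unit cube for all smooth densities in `[1, 1 + c]`
with a uniform Lipschitz bound, then it is weakly solvable on the whole space. -/
lemma exists_isWeakSolution_of_forall_unitCube {c : ℝ} {K : ℝ≥0}
    (hsol : ∀ ρ : EuclideanSpace ℝ (Fin d) → ℝ, ContDiff ℝ (⊤ : ℕ∞) ρ →
      (∀ x, ρ x ∈ Icc 1 (1 + c)) →
      ∃ ψ : EuclideanSpace ℝ (Fin d) → EuclideanSpace ℝ (Fin d),
        LipschitzOnWith K ψ (unitCube d) ∧
        ∀ᵐ x ∂(volume.restrict (unitCube d)),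
          ∃ D : EuclideanSpace ℝ (Fin d) →L[ℝ] EuclideanSpace ℝ (Fin d),
            HasFDerivWithinAt ψ D (unitCube d) x ∧ LinearMap.det D.toLinearMap = ρ x)
    {ρ : EuclideanSpace ℝ (Fin d) → ℝ} (hρ : ContDiff ℝ (⊤ : ℕ∞) ρ)
    (hρc : ∀ x, ρ x ∈ Icc 1 (1 + c)) :
    ∃ ψ, IsWeakSolution volume (lipschitzExtensionConstant (EuclideanSpace ℝ (Fin d)) * K) ρ ψ := by
  set q := cubeCenter d
  have hex (n : ℕ) : ∃ φ : EuclideanSpace ℝ (Fin d) → EuclideanSpace ℝ (Fin d),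
      LipschitzWith (lipschitzExtensionConstant (EuclideanSpace ℝ (Fin d)) * K) φ ∧
      ∀ s ⊆ ball q (1 / 2), ∫ y in s, (fderiv ℝ φ y).det =
        ∫ y in s, ρ (((n : ℝ) + 1) • (y - q)) := by
    obtain ⟨ψ, hψ, hdet⟩ := hsol (fun y => ρ (((n : ℝ) + 1) • (y - q)))
      (hρ.comp ((contDiff_id.sub contDiff_const).const_smul _)) (fun x => hρc _)
    exact exists_lipschitzWith_integral_det_eq hψ hdet
  choose φ hφ hint using hex
  have hpos (n : ℕ) : (0 : ℝ) < ((n : ℝ) + 1)⁻¹ := by positivity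
  have hU : (hyperfilter ℕ : Filter ℕ) ≤ atTop := Nat.hyperfilter_le_atTop
  have hzoom (x : EuclideanSpace ℝ (Fin d)) (r : ℝ) : ∀ᶠ n : ℕ in (hyperfilter ℕ : Filter ℕ),
      ∫ y in closedBall x r, (fderiv ℝ (zoom q ((n : ℝ) + 1)⁻¹ (φ n)) y).det =
        ∫ y in closedBall x r, ρ y := by
    obtain ⟨N, hN⟩ := exists_nat_gt (2 * (‖x‖ + r))
    filter_upwards [hU (eventually_ge_atTop N)] with n hn
    have hn' : (N : ℝ) ≤ n := by exact_mod_cast hn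
    rw [integral_det_fderiv_zoom volume q x (hpos n) (hint n _ ?_)]
    · refine integral_congr_ae (Eventually.of_forall fun y => ?_)
      have : (n : ℝ) + 1 ≠ 0 := by positivity
      simp [smul_smul, this]
    · intro y hy
      have h1 : dist y q ≤ ((n : ℝ) + 1)⁻¹ * r + ((n : ℝ) + 1)⁻¹ * ‖x‖ := by
        refine (dist_triangle _ _ _).trans (add_le_add hy ?_)
        rw [dist_eq_norm, add_sub_cancel_left, norm_smul, Real.norm_of_nonneg (hpos n).le]
      refine mem_ball.2 (h1.trans_lt ?_)
      rw [← mul_add, inv_mul_lt_iff₀ (by positivity)]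
      linarith
  obtain ⟨ψ, hψ, -⟩ := exists_isWeakSolution_of_tendsto (hyperfilter ℕ)
    (fun n => lipschitzWith_zoom (hφ n) q (hpos n)) (fun n => zoom_zero _ _ _)
    (fun x r _ => hzoom x r) (fun x r hr => tendsto_const_nhds)
  exact ⟨ψ, hψ⟩

end Globalization

section Density

/-- A density oscillating between `1` at even integers and `1 + c` at odd integers. -/
def waveDensity (c t : ℝ) : ℝ := 1 + c * ((1 - Real.cos (Real.pi * t)) / 2)

lemma contDiff_waveDensity (c : ℝ) : ContDiff ℝ (⊤ : ℕ∞) (waveDensity c) := by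
  unfold waveDensity
  fun_prop

lemma waveDensity_mem_Icc {c : ℝ} (hc : 0 ≤ c) (t : ℝ) : waveDensity c t ∈ Icc 1 (1 + c) := by
  unfold waveDensity
  constructor <;>
    nlinarith [Real.cos_le_one (Real.pi * t), Real.neg_one_le_cos (Real.pi * t)]

lemma waveDensity_add_two_mul (c t : ℝ) (k : ℤ) : waveDensity c (t + 2 * k) = waveDensity c t := by
  unfold waveDensity
  rw [show Real.pi * (t + 2 * k) = Real.pi * t + k * (2 * Real.pi) by ring,
    Real.cos_add_int_mul_two_pi]

lemma waveDensity_add_one (c t : ℝ) :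
    waveDensity c (t + 1) = waveDensity c t + c * Real.cos (Real.pi * t) := by
  unfold waveDensity
  rw [mul_add, mul_one, Real.cos_add_pi]
  ring

/-- A smooth cutoff equal to `1` close to the multiples of `1 / n`, whose support shrinks to these
points as `N` grows. -/
def stripCutoff (n N : ℕ) (t : ℝ) : ℝ :=
  Real.smoothTransition (2 - (N * Real.sin (Real.pi * (n * t))) ^ 2)

lemma contDiff_stripCutoff (n N : ℕ) : ContDiff ℝ (⊤ : ℕ∞) (stripCutoff n N) := by
  unfold stripCutoff
  exact Real.smoothTransition.contDiff.comp (by fun_prop)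

lemma stripCutoff_nonneg (n N : ℕ) (t : ℝ) : 0 ≤ stripCutoff n N t :=
  Real.smoothTransition.nonneg _

lemma stripCutoff_le_one (n N : ℕ) (t : ℝ) : stripCutoff n N t ≤ 1 :=
  Real.smoothTransition.le_one _

lemma stripCutoff_eq_one {n N : ℕ} {t s : ℝ} {k : ℤ} (ht : n * t = k + s)
    (hs : Real.pi * |s| * N ≤ 1) : stripCutoff n N t = 1 := by
  refine Real.smoothTransition.one_of_one_le ?_
  have h1 : |N * Real.sin (Real.pi * (n * t))| ≤ 1 := by
    rw [ht, mul_add, mul_comm _ (k : ℝ), add_comm, Real.sin_add_int_mul_pi, abs_mul, abs_mul,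
      abs_zpow, abs_neg, abs_one, one_zpow, one_mul, Nat.abs_cast]
    have h2 : |Real.sin (Real.pi * s)| ≤ Real.pi * |s| := by
      refine (Real.abs_sin_le_abs).trans_eq ?_
      rw [abs_mul, abs_of_pos Real.pi_pos]
    calc _ ≤ N * (Real.pi * |s|) := by gcongr
      _ ≤ 1 := by linarith
  have h3 := (sq_le_one_iff_abs_le_one _).2 h1
  linarith

lemma tendsto_stripCutoff {n : ℕ} {t : ℝ} (h : Real.sin (Real.pi * (n * t)) ≠ 0) :
    Tendsto (fun N => stripCutoff n N t) atTop (𝓝 0) := by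
  refine tendsto_const_nhds.congr' ?_
  have h1 : 0 < Real.sin (Real.pi * (n * t)) ^ 2 := by positivity
  obtain ⟨M, hM⟩ := exists_nat_gt (2 / Real.sin (Real.pi * (n * t)) ^ 2)
  filter_upwards [eventually_ge_atTop (max M 1)] with N hN
  have hN1 : (1 : ℝ) ≤ N := by exact_mod_cast (le_max_right _ _).trans hN
  have hNM : (M : ℝ) ≤ N := by exact_mod_cast (le_max_left _ _).trans hN
  refine (Real.smoothTransition.zero_of_nonpos ?_).symm
  rw [div_lt_iff₀ h1] at hM
  rw [mul_pow]
  have h2 : (M : ℝ) ≤ N ^ 2 := by nlinarith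
  nlinarith

variable {d : ℕ}

lemma ae_sin_coord_ne_zero (i : Fin d) {n : ℕ} (hn : 0 < n) :
    ∀ᵐ x : EuclideanSpace ℝ (Fin d), Real.sin (Real.pi * (n * x i)) ≠ 0 := by
  have hcount : (range fun k : ℤ => (k : ℝ) / n).Countable := countable_range _
  have h1 := (Measure.quasiMeasurePreserving_eval (fun _ : Fin d => (volume : Measure ℝ)) i).ae
    (hcount.ae_notMem volume)
  have h2 := (EuclideanSpace.volume_preserving_symm_measurableEquiv_toLp
    (Fin d)).quasiMeasurePreserving.ae h1
  filter_upwards [h2] with x hx hsin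
  obtain ⟨k, hk⟩ := Real.sin_eq_zero_iff.1 hsin
  refine hx ⟨k, ?_⟩
  have hn' : (n : ℝ) ≠ 0 := by positivity
  have : (k : ℝ) = n * x i := by
    have := Real.pi_pos.ne'
    apply mul_right_cancel₀ this
    linarith
  simp only [this, Function.eval]
  field_simp
  rfl

lemma tendsto_integral_stripCutoff (i : Fin d) {n : ℕ} (hn : 0 < n)
    (s : Set (EuclideanSpace ℝ (Fin d))) (hs : volume s ≠ ⊤) :
    Tendsto (fun N => ∫ x in s, stripCutoff n N (x i)) atTop (𝓝 0) := by
  have : IsFiniteMeasure (volume.restrict s) := ⟨by simpa using hs.lt_top⟩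
  have h := tendsto_integral_of_dominated_convergence
    (μ := (volume : Measure (EuclideanSpace ℝ (Fin d))).restrict s)
    (F := fun N x => stripCutoff n N (x i)) (f := fun _ => 0)
    (fun _ => 1) (fun N => ?_) (integrable_const _) (fun N => ?_) ?_
  · simpa using h
  · exact ((contDiff_stripCutoff n N).continuous.comp
      (by fun_prop : Continuous fun x : EuclideanSpace ℝ (Fin d) => x i)).aestronglyMeasurable
  · refine Eventually.of_forall fun x => ?_
    rw [Real.norm_of_nonneg (stripCutoff_nonneg _ _ _)]
    exact stripCutoff_le_one _ _ _
  · filter_upwards [ae_restrict_of_ae (ae_sin_coord_ne_zero i hn)] with x hx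
    exact tendsto_stripCutoff hx

/-- Modification of `ρ` which, close to the hyperplanes where `n * x i₁` is an integer, oscillates
in the direction of the `i₀`-th coordinate at scale `1 / (n * N)`. -/
def stripDensity (c : ℝ) (n N : ℕ) (i₀ i₁ : Fin d) (ρ : EuclideanSpace ℝ (Fin d) → ℝ)
    (x : EuclideanSpace ℝ (Fin d)) : ℝ :=
  ρ x + stripCutoff n N (x i₁) * (waveDensity c (n * N * x i₀) - ρ x)

variable {c : ℝ} {n N : ℕ} {i₀ i₁ : Fin d} {ρ : EuclideanSpace ℝ (Fin d) → ℝ}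

lemma contDiff_stripDensity (hρ : ContDiff ℝ (⊤ : ℕ∞) ρ) :
    ContDiff ℝ (⊤ : ℕ∞) (stripDensity c n N i₀ i₁ ρ) := by
  have h1 : ContDiff ℝ (⊤ : ℕ∞) fun x : EuclideanSpace ℝ (Fin d) => stripCutoff n N (x i₁) :=
    (contDiff_stripCutoff n N).comp (by fun_prop)
  have h2 : ContDiff ℝ (⊤ : ℕ∞)
      fun x : EuclideanSpace ℝ (Fin d) => waveDensity c (n * N * x i₀) :=
    (contDiff_waveDensity c).comp (by fun_prop)
  exact hρ.add (h1.mul (h2.sub hρ))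

lemma stripDensity_mem_Icc (hc : 0 ≤ c) (hρc : ∀ x, ρ x ∈ Icc 1 (1 + c))
    (x : EuclideanSpace ℝ (Fin d)) : stripDensity c n N i₀ i₁ ρ x ∈ Icc 1 (1 + c) := by
  have h := (convex_Icc (1 : ℝ) (1 + c)).add_smul_sub_mem (hρc x)
    (waveDensity_mem_Icc hc (n * N * x i₀)) ⟨stripCutoff_nonneg n N (x i₁), stripCutoff_le_one _ _ _⟩
  exact h

lemma abs_stripDensity_sub_le (hc : 0 ≤ c) (hρc : ∀ x, ρ x ∈ Icc 1 (1 + c))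
    (x : EuclideanSpace ℝ (Fin d)) :
    |stripDensity c n N i₀ i₁ ρ x - ρ x| ≤ c * stripCutoff n N (x i₁) := by
  have h1 := hρc x
  have h2 := waveDensity_mem_Icc hc (n * N * x i₀)
  rw [stripDensity, add_sub_cancel_left, abs_mul, abs_of_nonneg (stripCutoff_nonneg _ _ _),
    mul_comm]
  refine mul_le_mul_of_nonneg_right ?_ (stripCutoff_nonneg _ _ _)
  rw [abs_le]
  constructor <;> linarith [h1.1, h1.2, h2.1, h2.2]

lemma stripDensity_add_smul (hn : 0 < n) {m : ℕ} (hm : 0 < m) (hi : i₁ ≠ i₀)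
    {p y : EuclideanSpace ℝ (Fin d)} {k₀ k₁ : ℤ} (hp₀ : n * p i₀ = k₀) (hp₁ : n * p i₁ = k₁)
    (j : ℕ) (hy : |y i₁| ≤ 1 / 4) {h : ℝ} (hh : h = (2 * m * n : ℝ)⁻¹) :
    stripDensity c n (2 * m) i₀ i₁ ρ
      (p + (2 * j * h) • EuclideanSpace.single i₀ 1 + h • y) = waveDensity c (y i₀) := by
  have hn' : (n : ℝ) ≠ 0 := by positivity
  have hm' : (m : ℝ) ≠ 0 := by positivity
  have hcut : stripCutoff n (2 * m)
      ((p + (2 * j * h) • EuclideanSpace.single i₀ (1 : ℝ) + h • y) i₁) = 1 := by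
    refine stripCutoff_eq_one (k := k₁) (s := (2 * m : ℝ)⁻¹ * y i₁) ?_ ?_
    · simp only [PiLp.add_apply, PiLp.smul_apply, PiLp.single_apply, hi, if_false,
        smul_eq_mul, mul_zero, add_zero, mul_add, hp₁, hh]
      field_simp
    · rw [abs_mul, abs_of_nonneg (by positivity)]
      push_cast
      have : Real.pi * ((2 * m : ℝ)⁻¹ * |y i₁|) * (2 * m) = Real.pi * |y i₁| := by field_simp
      rw [this]
      nlinarith [Real.pi_le_four, Real.pi_pos, abs_nonneg (y i₁)]
  rw [stripDensity, hcut, one_mul, add_sub_cancel,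
    ← waveDensity_add_two_mul c (y i₀) (m * k₀ + j)]
  congr 1
  simp only [PiLp.add_apply, PiLp.smul_apply, PiLp.single_apply, if_true, smul_eq_mul,
    mul_one, hh]
  push_cast
  rw [← hp₀]
  field_simp
  ring

end Density

section DensityIntegrals

variable {d : ℕ} {c : ℝ}

lemma exists_stripDensity_integral_close (hc : 0 ≤ c) {ρ : EuclideanSpace ℝ (Fin d) → ℝ}
    (hρ : ContDiff ℝ (⊤ : ℕ∞) ρ) (hρc : ∀ x, ρ x ∈ Icc 1 (1 + c)) (i₀ i₁ : Fin d) {n : ℕ}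
    (hn : 0 < n) (m₀ : ℕ) (R : ℝ) {δ : ℝ} (hδ : 0 < δ) :
    ∃ m ≥ m₀, ∀ x r, closedBall x r ⊆ closedBall 0 R →
      |(∫ y in closedBall x r, stripDensity c n (2 * m) i₀ i₁ ρ y)
        - ∫ y in closedBall x r, ρ y| ≤ δ := by
  have hlim : Tendsto (fun m => ∫ y in closedBall (0 : EuclideanSpace ℝ (Fin d)) R,
      c * stripCutoff n (2 * m) (y i₁)) atTop (𝓝 0) := by
    have h1 := (tendsto_integral_stripCutoff i₁ hn
      (closedBall (0 : EuclideanSpace ℝ (Fin d)) R) measure_closedBall_lt_top.ne).const_mul c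
    simp_rw [integral_const_mul]
    rw [mul_zero] at h1
    exact h1.comp (tendsto_id.const_mul_atTop' two_pos)
  obtain ⟨m, hm, hmδ⟩ := ((eventually_ge_atTop m₀).and (hlim.eventually_le_const hδ)).exists
  refine ⟨m, hm, fun x r hxr => le_trans ?_ hmδ⟩
  have hcont : Continuous (stripDensity c n (2 * m) i₀ i₁ ρ) :=
    (contDiff_stripDensity hρ).continuous
  have hcut : Continuous fun y : EuclideanSpace ℝ (Fin d) => c * stripCutoff n (2 * m) (y i₁) :=
    continuous_const.mul ((contDiff_stripCutoff n (2 * m)).continuous.comp (by fun_prop))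
  have hint {f : EuclideanSpace ℝ (Fin d) → ℝ} (hf : Continuous f)
      (x : EuclideanSpace ℝ (Fin d)) (r : ℝ) : IntegrableOn f (closedBall x r) :=
    hf.continuousOn.integrableOn_compact (isCompact_closedBall x r)
  rw [← integral_sub (hint hcont x r) (hint hρ.continuous x r)]
  calc |∫ y in closedBall x r, (stripDensity c n (2 * m) i₀ i₁ ρ y - ρ y)|
      ≤ ∫ y in closedBall x r, |stripDensity c n (2 * m) i₀ i₁ ρ y - ρ y| :=
        abs_integral_le_integral_abs
    _ ≤ ∫ y in closedBall x r, c * stripCutoff n (2 * m) (y i₁) :=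
        integral_mono (hint (hcont.sub hρ.continuous).abs x r) (hint hcut x r)
          fun y => abs_stripDensity_sub_le hc hρc y
    _ ≤ ∫ y in closedBall (0 : EuclideanSpace ℝ (Fin d)) R, c * stripCutoff n (2 * m) (y i₁) :=
        setIntegral_mono_set (hint hcut 0 R)
          (Eventually.of_forall fun y => mul_nonneg hc (stripCutoff_nonneg _ _ _))
          hxr.eventuallyLE

lemma integral_waveDensity_ne (hc : 0 < c) (i : Fin d) :
    ∫ y in closedBall (0 : EuclideanSpace ℝ (Fin d)) (1 / 4), waveDensity c (y i) ≠
      ∫ y in closedBall (EuclideanSpace.single i 1) (1 / 4), waveDensity c (y i) := by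
  have hpre : closedBall (0 : EuclideanSpace ℝ (Fin d)) (1 / 4) =
      (fun z => EuclideanSpace.single i 1 + z) ⁻¹'
        closedBall (EuclideanSpace.single i 1) (1 / 4) := by
    ext z; simp
  have htrans := (measurePreserving_add_left (volume : Measure (EuclideanSpace ℝ (Fin d)))
    (EuclideanSpace.single i 1)).setIntegral_preimage_emb
    (Homeomorph.addLeft (EuclideanSpace.single i (1 : ℝ))).measurableEmbedding
    (fun y => waveDensity c (y i)) (closedBall (EuclideanSpace.single i 1) (1 / 4))
  rw [← hpre] at htrans
  have hstep (z : EuclideanSpace ℝ (Fin d)) :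
      waveDensity c ((EuclideanSpace.single i 1 + z : EuclideanSpace ℝ (Fin d)) i) =
        waveDensity c (z i) + c * Real.cos (Real.pi * z i) := by
    rw [← waveDensity_add_one]
    simp [add_comm]
  have hwave : Continuous fun z : EuclideanSpace ℝ (Fin d) => waveDensity c (z i) :=
    (contDiff_waveDensity c).continuous.comp (by fun_prop)
  have hcos : Continuous fun z : EuclideanSpace ℝ (Fin d) => c * Real.cos (Real.pi * z i) := by
    fun_prop
  have hint {f : EuclideanSpace ℝ (Fin d) → ℝ} (hf : Continuous f) :
      IntegrableOn f (closedBall 0 (1 / 4)) :=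
    hf.continuousOn.integrableOn_compact (isCompact_closedBall _ _)
  have hpos (z : EuclideanSpace ℝ (Fin d)) (hz : z ∈ closedBall 0 (1 / 4)) :
      0 < c * Real.cos (Real.pi * z i) := by
    have h1 := (PiLp.norm_apply_le z i).trans (mem_closedBall_zero_iff.1 hz)
    rw [Real.norm_eq_abs, abs_le] at h1
    exact mul_pos hc (Real.cos_pos_of_mem_Ioo
      ⟨by nlinarith [Real.pi_pos, h1.1], by nlinarith [Real.pi_pos, h1.2]⟩)
  have hint_pos : 0 < ∫ z in closedBall (0 : EuclideanSpace ℝ (Fin d)) (1 / 4),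
      c * Real.cos (Real.pi * z i) := by
    rw [setIntegral_pos_iff_support_of_nonneg_ae ?_ (hint hcos)]
    · refine (measure_closedBall_pos volume (0 : EuclideanSpace ℝ (Fin d))
        (by norm_num : (0 : ℝ) < 1 / 4)).trans_le (measure_mono fun z hz => ?_)
      exact ⟨(hpos z hz).ne', hz⟩
    · filter_upwards [ae_restrict_mem measurableSet_closedBall] with z hz
      exact (hpos z hz).le
  rw [← htrans]
  simp_rw [hstep]
  rw [integral_add (hint hwave) (hint hcos)]
  linarith

end DensityIntegrals

section Grid

variable {d : ℕ}

/-- The points whose coordinates with indices `i₀` and `i₁` are multiples of `1 / n`. -/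
def IsGridPoint (n : ℕ) (i₀ i₁ : Fin d) (p : EuclideanSpace ℝ (Fin d)) : Prop :=
  (∃ k : ℤ, n * p i₀ = k) ∧ ∃ k : ℤ, n * p i₁ = k

variable {n : ℕ} {i₀ i₁ : Fin d}

lemma exists_isGridPoint_norm_sub_le (hn : 0 < n) (hi : i₁ ≠ i₀) (x : EuclideanSpace ℝ (Fin d)) :
    ∃ p, IsGridPoint n i₀ i₁ p ∧ ‖x - p‖ ≤ 2 * (n : ℝ)⁻¹ := by
  have hn' : (0 : ℝ) < n := by exact_mod_cast hn
  refine ⟨x - ((Int.fract (n * x i₀) * (n : ℝ)⁻¹) • EuclideanSpace.single i₀ 1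
    + (Int.fract (n * x i₁) * (n : ℝ)⁻¹) • EuclideanSpace.single i₁ 1),
    ⟨⟨⌊n * x i₀⌋, ?_⟩, ⌊n * x i₁⌋, ?_⟩, ?_⟩
  · have h1 := Int.self_sub_fract (n * x i₀)
    simp [hi.symm, mul_sub]
    field_simp
    linarith
  · have h1 := Int.self_sub_fract (n * x i₁)
    simp [hi, mul_sub]
    field_simp
    linarith
  · rw [sub_sub_cancel]
    have h1 (i : Fin d) : ‖(Int.fract (n * x i) * (n : ℝ)⁻¹) •
        (EuclideanSpace.single i 1 : EuclideanSpace ℝ (Fin d))‖ ≤ (n : ℝ)⁻¹ := by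
      rw [norm_smul, PiLp.norm_single, norm_one, mul_one,
        Real.norm_of_nonneg (mul_nonneg (Int.fract_nonneg _) (by positivity))]
      exact mul_le_of_le_one_left (by positivity) (Int.fract_lt_one _).le
    linarith [norm_add_le_of_le (h1 i₀) (h1 i₁)]

lemma IsGridPoint.add_smul (hn : 0 < n) (hi : i₁ ≠ i₀) {p : EuclideanSpace ℝ (Fin d)}
    (hp : IsGridPoint n i₀ i₁ p) (j : ℕ) :
    IsGridPoint n i₀ i₁ (p + (j * (n : ℝ)⁻¹) • EuclideanSpace.single i₀ 1) := by
  obtain ⟨⟨k₀, hk₀⟩, k₁, hk₁⟩ := hp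
  have hn' : (n : ℝ) ≠ 0 := by positivity
  refine ⟨⟨k₀ + j, ?_⟩, k₁, ?_⟩
  · simp [mul_add, hk₀]
    field_simp
  · simp [hi, hk₁]

lemma norm_sub_le_of_isGridPoint (hn : 0 < n) (hi : i₁ ≠ i₀) {A : ℝ}
    {ψ : EuclideanSpace ℝ (Fin d) → EuclideanSpace ℝ (Fin d)}
    (hgrid : ∀ p, IsGridPoint n i₀ i₁ p →
      ‖ψ (p + (n : ℝ)⁻¹ • EuclideanSpace.single i₀ 1) - ψ p‖ ≤ A * (n : ℝ)⁻¹)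
    {p : EuclideanSpace ℝ (Fin d)} (hp : IsGridPoint n i₀ i₁ p) (j : ℕ) :
    ‖ψ (p + (j * (n : ℝ)⁻¹) • EuclideanSpace.single i₀ 1) - ψ p‖ ≤ A * (j * (n : ℝ)⁻¹) := by
  induction j with
  | zero => simp
  | succ j ih =>
    have h1 := hgrid _ (hp.add_smul hn hi j)
    rw [add_assoc, ← _root_.add_smul] at h1
    push_cast
    rw [add_mul, one_mul, mul_add]
    calc _ ≤ _ := norm_sub_le_norm_sub_add_norm_sub _
          (ψ (p + (j * (n : ℝ)⁻¹) • EuclideanSpace.single i₀ 1)) _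
      _ ≤ _ := by linarith

lemma norm_sub_le_add_of_isGridPoint (hn : 0 < n) (hi : i₁ ≠ i₀) {A : ℝ} {K : ℝ≥0}
    {ψ : EuclideanSpace ℝ (Fin d) → EuclideanSpace ℝ (Fin d)} (hψ : LipschitzWith K ψ)
    (hA : 0 ≤ A)
    (hgrid : ∀ p, IsGridPoint n i₀ i₁ p →
      ‖ψ (p + (n : ℝ)⁻¹ • EuclideanSpace.single i₀ 1) - ψ p‖ ≤ A * (n : ℝ)⁻¹)
    (x : EuclideanSpace ℝ (Fin d)) {t : ℝ} (ht : 0 ≤ t) :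
    ‖ψ (x + t • EuclideanSpace.single i₀ 1) - ψ x‖ ≤ A * t + 5 * K * (n : ℝ)⁻¹ := by
  have hn' : (0 : ℝ) < n := by exact_mod_cast hn
  obtain ⟨p, hp, hxp⟩ := exists_isGridPoint_norm_sub_le hn hi x
  set s : ℝ := ⌊n * t⌋₊ * (n : ℝ)⁻¹ with hs
  set e : EuclideanSpace ℝ (Fin d) := EuclideanSpace.single i₀ 1 with he
  have hst : s ≤ t := by
    rw [hs, ← div_eq_mul_inv, div_le_iff₀ hn', mul_comm]
    exact Nat.floor_le (by positivity)
  have hts : t - s ≤ (n : ℝ)⁻¹ := by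
    have h1 := (Nat.lt_floor_add_one (n * t)).le
    have h2 : t = n * t * (n : ℝ)⁻¹ := by field_simp
    rw [hs, h2, ← sub_mul]
    exact mul_le_of_le_one_left (by positivity) (by rw [← h2]; linarith)
  have h1 := norm_sub_le_of_isGridPoint hn hi hgrid hp ⌊n * t⌋₊
  have h2 : ‖ψ p - ψ x‖ ≤ K * (2 * (n : ℝ)⁻¹) := by
    refine (hψ.norm_sub_le p x).trans ?_
    rw [norm_sub_rev]
    gcongr
  have h3 : ‖ψ (x + t • e) - ψ (p + s • e)‖ ≤ K * (3 * (n : ℝ)⁻¹) := by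
    refine (hψ.norm_sub_le _ _).trans ?_
    gcongr
    rw [show x + t • e - (p + s • e) = (x - p) + (t - s) • e by module]
    refine (norm_add_le _ _).trans ?_
    rw [norm_smul, he, PiLp.norm_single, norm_one, mul_one, Real.norm_of_nonneg (by linarith)]
    linarith
  have h4 : A * s ≤ A * t := by gcongr
  rw [show ψ (x + t • e) - ψ x = (ψ (x + t • e) - ψ (p + s • e)) + (ψ (p + s • e) - ψ p)
    + (ψ p - ψ x) by abel]
  refine norm_add₃_le.trans ?_
  linarith

end Grid

section Extremal

variable {d : ℕ} {c : ℝ} {K : ℝ≥0} {i₀ i₁ : Fin d}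

/-- Every smooth density with values in `[1, 1 + c]` has a `K`-Lipschitz weak solution which
stretches the `i₀`-th coordinate direction at most by the factor `A`. -/
def SolvableWithStretch (c : ℝ) (K : ℝ≥0) (i₀ : Fin d) (A : ℝ) : Prop :=
  ∀ ρ : EuclideanSpace ℝ (Fin d) → ℝ, ContDiff ℝ (⊤ : ℕ∞) ρ → (∀ x, ρ x ∈ Icc 1 (1 + c)) →
    ∃ ψ, IsWeakSolution volume K ρ ψ ∧
      ∀ x t, 0 ≤ t → ‖ψ (x + t • EuclideanSpace.single i₀ 1) - ψ x‖ ≤ A * t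

lemma exists_forall_mul_add_div_le {K R ε : ℝ} (hK : 0 ≤ K) (hR : 0 ≤ R) (hε : 0 < ε) (k : ℕ) :
    ∃ η > 0, ∃ m₀ : ℕ, 0 < m₀ ∧ ∀ m ≥ m₀, ∀ A ≤ K,
      2 * (k + 1) * (2 * A * (η + K * R / m)) ≤ (ε / 2) ^ 2 := by
  have hC : 0 < 2 * (k + 1) * (2 * (K + 1)) := by positivity
  obtain ⟨η, hη, hηC⟩ : ∃ η > 0, 2 * (k + 1) * (2 * (K + 1)) * (2 * η) = (ε / 2) ^ 2 :=
    ⟨(ε / 2) ^ 2 / (2 * (2 * (k + 1) * (2 * (K + 1)))), by positivity, by field_simp⟩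
  obtain ⟨m₀, hm₀⟩ := exists_nat_gt (K * R / η)
  refine ⟨η, hη, max m₀ 1, by positivity, fun m hm A hA => ?_⟩
  have hm1 : (0 : ℝ) < m := by exact_mod_cast (le_max_right _ _).trans hm
  have hm2 : (m₀ : ℝ) ≤ m := by exact_mod_cast (le_max_left _ _).trans hm
  have h1 : 0 ≤ K * R / m := by positivity
  have h2 : K * R / m ≤ η := by
    rw [div_lt_iff₀ hη] at hm₀
    rw [div_le_iff₀ hm1]
    nlinarith
  have h3 : 2 * A * (η + K * R / m) ≤ 2 * (K + 1) * (2 * η) :=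
    mul_le_mul (by linarith) (by linarith) (by linarith) (by linarith)
  rw [← hηC, mul_assoc (2 * ((k : ℝ) + 1))]
  exact mul_le_mul_of_nonneg_left h3 (by positivity)

/-- A grid segment of a solution for an oscillating density cannot be stretched almost
maximally, because otherwise a zoom at a point of the segment has almost constant increments. -/
lemma exists_norm_sub_lt_of_isGridPoint (hc : 0 < c) (K : ℝ≥0) (hi : i₁ ≠ i₀) :
    ∃ η > 0, ∃ m₀ : ℕ, ∀ m ≥ m₀, ∀ n > 0, ∀ A ≤ (K : ℝ), ∀ ρ ψ,
      IsWeakSolution volume K (stripDensity c n (2 * m) i₀ i₁ ρ) ψ →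
      (∀ x t, 0 ≤ t → ‖ψ (x + t • EuclideanSpace.single i₀ 1) - ψ x‖ ≤ A * t) →
      ∀ p, IsGridPoint n i₀ i₁ p →
        ‖ψ (p + (n : ℝ)⁻¹ • EuclideanSpace.single i₀ 1) - ψ p‖ < (A - η) * (n : ℝ)⁻¹ := by
  set e : EuclideanSpace ℝ (Fin d) := EuclideanSpace.single i₀ 1 with he
  obtain ⟨F, ε, hε, hF⟩ := exists_finset_not_almost_constant_increment volume K e
    (by norm_num : (0 : ℝ) < 1 / 4) (integral_waveDensity_ne hc i₀)
  have hR : ∀ x ∈ F, ‖x‖ ≤ ∑ x ∈ F, ‖x‖ := fun x hx =>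
    Finset.single_le_sum (f := fun x => ‖x‖) (fun x _ => norm_nonneg x) hx
  have hRnonneg : 0 ≤ ∑ x ∈ F, ‖x‖ := Finset.sum_nonneg fun x _ => norm_nonneg x
  obtain ⟨η, hη, m₀, hm₀, hsmall⟩ := exists_forall_mul_add_div_le K.coe_nonneg hRnonneg hε F.card
  refine ⟨η, hη, m₀, fun m hm n hn A hAK ρ ψ hψ hA p hp => ?_⟩
  have hm1 : 0 < m := hm₀.trans_le hm
  have hm' : (0 : ℝ) < m := by exact_mod_cast hm1
  have hn' : (0 : ℝ) < n := by exact_mod_cast hn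
  by_contra! hstretch
  set h : ℝ := (2 * m * n : ℝ)⁻¹ with hh
  have hhpos : 0 < h := by positivity
  have hlen : 2 * m * h = (n : ℝ)⁻¹ := by rw [hh]; field_simp
  rw [← hlen] at hstretch
  obtain ⟨j, -, hj⟩ := exists_zoom_almost_constant_increment hψ.lipschitz hm1 hhpos hA hstretch F
    hRnonneg hR hε.le (hsmall m hm A hAK)
  set q := p + (2 * j * h) • e
  obtain ⟨⟨k₀, hk₀⟩, k₁, hk₁⟩ := hp
  have hint (x : EuclideanSpace ℝ (Fin d)) (hx : x i₁ = 0) :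
      ∫ y in closedBall x (1 / 4), (fderiv ℝ (zoom q h ψ) y).det =
        ∫ y in closedBall x (1 / 4), waveDensity c (y i₀) := by
    rw [integral_det_fderiv_zoom volume q x hhpos (hψ.integral_det _ _ (by positivity))]
    refine setIntegral_congr_fun measurableSet_closedBall fun y hy => ?_
    refine stripDensity_add_smul hn hm1 hi hk₀ hk₁ j ?_ hh
    have h1 := (PiLp.norm_apply_le (y - x) i₁).trans (mem_closedBall_iff_norm.1 hy)
    simpa [hx] using h1
  obtain ⟨x, hx, hlt⟩ := hF (zoom q h ψ) (lipschitzWith_zoom hψ.lipschitz q hhpos)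
    (zoom_zero _ _ _) (hint 0 (by simp)) (hint e (by simp [he, hi]))
  exact hlt.not_ge (hj x hx)

lemma exists_solvableWithStretch_sub (hc : 0 < c) (K : ℝ≥0) (hi : i₁ ≠ i₀) :
    ∃ η > 0, ∀ A ≤ (K : ℝ), SolvableWithStretch c K i₀ A → SolvableWithStretch c K i₀ (A - η) := by
  obtain ⟨η, hη, m₀, hgrid⟩ := exists_norm_sub_lt_of_isGridPoint hc K hi
  refine ⟨η, hη, fun A hAK hA ρ hρ hρc => ?_⟩
  have hpos (n : ℕ) : (0 : ℝ) < ((n + 1 : ℕ) : ℝ)⁻¹ := by positivity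
  choose m hm hclose using fun n : ℕ =>
    exists_stripDensity_integral_close hc.le hρ hρc i₀ i₁ n.succ_pos m₀ n (hpos n)
  choose ψ hψ hψA using fun n : ℕ =>
    hA (stripDensity c (n + 1) (2 * m n) i₀ i₁ ρ) (contDiff_stripDensity hρ)
      (stripDensity_mem_Icc hc.le hρc)
  have hle (n : ℕ) (p : EuclideanSpace ℝ (Fin d)) (hp : IsGridPoint (n + 1) i₀ i₁ p) :=
    (hgrid (m n) (hm n) (n + 1) n.succ_pos A hAK ρ (ψ n) (hψ n) (hψA n) p hp).le
  have hA0 : 0 ≤ A - η := by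
    have h1 := (norm_nonneg _).trans (hle 0 0 ⟨⟨0, by simp⟩, 0, by simp⟩)
    simpa using h1
  have hinv : Tendsto (fun n : ℕ => ((n + 1 : ℕ) : ℝ)⁻¹) atTop (𝓝 0) :=
    tendsto_inv_atTop_nhds_zero_nat.comp (tendsto_add_atTop_nat 1)
  have hU : (hyperfilter ℕ : Filter ℕ) ≤ atTop := Nat.hyperfilter_le_atTop
  have hσ (x : EuclideanSpace ℝ (Fin d)) (r : ℝ) :
      Tendsto (fun n => ∫ y in closedBall x r, stripDensity c (n + 1) (2 * m n) i₀ i₁ ρ y) atTop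
        (𝓝 (∫ y in closedBall x r, ρ y)) := by
    rw [tendsto_iff_norm_sub_tendsto_zero]
    refine squeeze_zero' (Eventually.of_forall fun n => norm_nonneg _) ?_ hinv
    obtain ⟨N, hN⟩ := exists_nat_gt (r + ‖x‖)
    filter_upwards [eventually_ge_atTop N] with n hn
    refine hclose n x r (closedBall_subset_closedBall' ?_)
    have hn' : (N : ℝ) ≤ n := by exact_mod_cast hn
    rw [dist_zero_right]
    linarith
  obtain ⟨φ, hφ, hlim⟩ := exists_isWeakSolution_of_tendsto (hyperfilter ℕ)
    (fun n => (hψ n).lipschitz) (fun n => (hψ n).map_zero)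
    (fun x r hr => Eventually.of_forall fun n => (hψ n).integral_det x r hr)
    (fun x r _ => (hσ x r).mono_left hU)
  refine ⟨φ, hφ, fun x t ht => ?_⟩
  refine le_of_tendsto_of_tendsto' ((hlim _).sub (hlim _)).norm
    (b := hyperfilter ℕ) (g := fun n : ℕ => (A - η) * t + 5 * K * ((n + 1 : ℕ) : ℝ)⁻¹) ?_
    fun n => norm_sub_le_add_of_isGridPoint n.succ_pos hi (hψ n).lipschitz hA0 (hle n) x ht
  simpa using tendsto_const_nhds.add ((hinv.mono_left hU).const_mul (5 * (K : ℝ)))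

/-- For some smooth density with values in `[1, 1 + c]` there is no `K`-Lipschitz weak solution of
the Jacobian equation. -/
theorem exists_contDiff_forall_not_isWeakSolution (hd : 2 ≤ d) (hc : 0 < c) (K : ℝ≥0) :
    ∃ ρ : EuclideanSpace ℝ (Fin d) → ℝ, ContDiff ℝ (⊤ : ℕ∞) ρ ∧ (∀ x, ρ x ∈ Icc 1 (1 + c)) ∧
      ∀ ψ, ¬ IsWeakSolution volume K ρ ψ := by
  by_contra! hcon
  let i₀ : Fin d := ⟨0, by omega⟩
  let i₁ : Fin d := ⟨1, by omega⟩
  have hi : i₁ ≠ i₀ := by simp [i₀, i₁]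
  obtain ⟨η, hη, hstep⟩ := exists_solvableWithStretch_sub hc K hi
  set S : Set ℝ := {A | SolvableWithStretch c K i₀ A} with hS
  have hKS : (K : ℝ) ∈ S := by
    intro ρ hρ hρc
    obtain ⟨ψ, hψ⟩ := hcon ρ hρ hρc
    refine ⟨ψ, hψ, fun x t ht => (hψ.lipschitz.norm_sub_le _ _).trans_eq ?_⟩
    rw [add_sub_cancel_left, norm_smul, PiLp.norm_single, norm_one, mul_one,
      Real.norm_of_nonneg ht]
  have hbdd : BddBelow S := by
    refine ⟨0, fun A hA => ?_⟩
    obtain ⟨ψ, -, hψ⟩ := hA (fun _ => 1) contDiff_const fun _ => ⟨le_rfl, by linarith⟩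
    simpa using (norm_nonneg _).trans (hψ 0 1 zero_le_one)
  obtain ⟨A, hAS, hA⟩ := exists_lt_of_csInf_lt ⟨_, hKS⟩ (lt_add_of_pos_right (sInf S) hη)
  have hmin : min A K ∈ S := by
    rcases min_choice A K with h | h <;> rw [h] <;> assumption
  have h1 := csInf_le hbdd (hstep _ (min_le_right A K) hmin)
  linarith [min_le_left A (K : ℝ)]

end Extremal

/-- Burago–Kleiner lemma: for every L > 1 and c > 0 there is a smooth density ρ with
values in [1, 1+c] on the unit cube such that no L-biLipschitz map ψ on the cube solves
the Jacobian equation det Dψ = ρ almost everywhere. -/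
theorem burago_kleiner (d : ℕ) (hd : 2 ≤ d) (L : ℝ) (hL : 1 < L) (c : ℝ) (hc : 0 < c) :
    ∃ ρ : EuclideanSpace ℝ (Fin d) → ℝ, ContDiff ℝ (⊤ : ℕ∞) ρ ∧
      (∀ x ∈ unitCube d, 1 ≤ ρ x ∧ ρ x ≤ 1 + c) ∧
      ¬ ∃ ψ : EuclideanSpace ℝ (Fin d) → EuclideanSpace ℝ (Fin d),
        (∀ x ∈ unitCube d, ∀ y ∈ unitCube d,
          L⁻¹ * ‖x - y‖ ≤ ‖ψ x - ψ y‖ ∧ ‖ψ x - ψ y‖ ≤ L * ‖x - y‖) ∧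
        (∀ᵐ x ∂(MeasureTheory.volume.restrict (unitCube d)),
          ∃ D : EuclideanSpace ℝ (Fin d) →L[ℝ] EuclideanSpace ℝ (Fin d),
            HasFDerivWithinAt ψ D (unitCube d) x ∧
            LinearMap.det D.toLinearMap = ρ x) := by
  by_contra! hcon
  obtain ⟨ρ, hρ, hρc, hnot⟩ := exists_contDiff_forall_not_isWeakSolution hd hc
    (lipschitzExtensionConstant (EuclideanSpace ℝ (Fin d)) * L.toNNReal)
  obtain ⟨ψ, hψ⟩ := exists_isWeakSolution_of_forall_unitCube (K := L.toNNReal) (c := c) (by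
    intro σ hσ hσc
    obtain ⟨ψ, hlip, hdet⟩ := hcon σ hσ fun x _ => hσc x
    refine ⟨ψ, LipschitzOnWith.of_dist_le_mul fun x hx y hy => ?_, hdet⟩
    rw [dist_eq_norm, dist_eq_norm, Real.coe_toNNReal L (by linarith)]
    exact (hlip x hx y hy).2) hρ hρc
  exact hnot ψ hψ
end
end

section
/- (No bounded right inverse for the Jacobian determinant equation.) Let d ≥ 2 and Iᵈ = [0,1]ᵈ. For every K > 0 and every ε > 0, there is no map 𝓛 that assigns to each C^∞ function f : ℝᵈ → ℝ with ‖f − 1‖_{C⁰(Iᵈ)} ≤ ε a C¹ map 𝓛f : Iᵈ → ℝᵈ such that both: (i) det D(𝓛f)(x) = f(x) for all x ∈ Iᵈ, and (ii) ‖𝓛f‖_{C¹(Iᵈ)} ≤ K·‖f‖_{C⁰(Iᵈ)}. -/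
noncomputable section

/-- C⁰ norm on the unit cube. -/
def c0Norm {d : ℕ} (g : EuclideanSpace ℝ (Fin d) → ℝ) : ℝ :=
  sSup ((fun x => |g x|) '' unitCube d)

/-- C¹ norm on the unit cube. -/
def c1Norm {d : ℕ} (v : EuclideanSpace ℝ (Fin d) → EuclideanSpace ℝ (Fin d)) : ℝ :=
  sSup ((fun x => ‖v x‖ + ‖fderiv ℝ v x‖) '' unitCube d)

open MeasureTheory Set Filter Topology
open scoped NNReal

/-- The `d`-th finite difference of `t ↦ det (1 + t B)` extracts the leading coefficient
`det B`. -/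
theorem Matrix.sum_choose_smul_det_one_add {d : ℕ} (B : Matrix (Fin d) (Fin d) ℝ) :
    ∑ k ∈ Finset.range (d + 1), ((-1 : ℝ) ^ (d - k) * d.choose k) * (1 + (k : ℝ) • B).det =
      (d.factorial : ℝ) * B.det := by
  open Polynomial in
  set P : ℝ[X] := det ((X : ℝ[X]) • B.map C + (1 : Matrix (Fin d) (Fin d) ℝ).map C) with hP
  have heval (t : ℝ) : P.eval t = (1 + t • B).det := by
    rw [hP, ← Polynomial.coe_evalRingHom, RingHom.map_det]
    congr 1
    ext i j
    by_cases h : i = j <;> simp [h, add_comm, mul_comm (B _ _)]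
  have hdeg : P.natDegree ≤ d := by
    simpa only [Fintype.card_fin] using Polynomial.natDegree_det_X_add_C_le B 1
  have hcoeff : P.coeff d = B.det := by
    simpa only [Fintype.card_fin] using Polynomial.coeff_det_X_add_C_card B 1
  have hdiff : (fwdDiff (1 : ℝ))^[d] P.eval 0 = P.coeff d * d.factorial := by
    rcases hdeg.eq_or_lt with h | h
    · have := congrFun P.fwdDiff_iter_degree_eq_factorial 0
      rw [h] at this
      rw [this]
      simp [Polynomial.leadingCoeff, h]
    · rw [Polynomial.fwdDiff_iter_eq_zero_of_degree_lt h, Polynomial.coeff_eq_zero_of_natDegree_lt h]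
      simp
  rw [fwdDiff_iter_eq_sum_shift] at hdiff
  simp only [zero_add, nsmul_eq_mul, mul_one, heval, zsmul_eq_mul] at hdiff
  push_cast at hdiff
  rw [hdiff, hcoeff, mul_comm]

variable {d : ℕ}

local notation "𝔼" d => EuclideanSpace ℝ (Fin d)

theorem ContinuousLinearMap.det_eq_det_matrix (A : (𝔼 d) →L[ℝ] 𝔼 d) :
    A.det = (Matrix.of fun i j => A (EuclideanSpace.single j 1) i).det := by
  rw [ContinuousLinearMap.det, ← LinearMap.det_toMatrix (EuclideanSpace.basisFun (Fin d) ℝ).toBasis]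
  rfl

theorem ContinuousLinearMap.sum_choose_smul_det_one_add (B : (𝔼 d) →L[ℝ] 𝔼 d) :
    ∑ k ∈ Finset.range (d + 1), ((-1 : ℝ) ^ (d - k) * d.choose k) *
      (ContinuousLinearMap.id ℝ (𝔼 d) + (k : ℝ) • B).det = (d.factorial : ℝ) * B.det := by
  rw [ContinuousLinearMap.det_eq_det_matrix B, ← Matrix.sum_choose_smul_det_one_add]
  refine Finset.sum_congr rfl fun k _ => ?_
  rw [ContinuousLinearMap.det_eq_det_matrix]
  congr 2
  ext i j
  simp [Matrix.one_apply]

theorem ContinuousLinearMap.det_id_add_pos_of_norm_lt_one (B : (𝔼 d) →L[ℝ] 𝔼 d) (hB : ‖B‖ < 1) :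
    0 < (ContinuousLinearMap.id ℝ (𝔼 d) + B).det := by
  set g : ℝ → ℝ := fun s => (ContinuousLinearMap.id ℝ (𝔼 d) + s • B).det with hg
  have hcont : Continuous g := ContinuousLinearMap.continuous_det.comp (by fun_prop)
  have hne : ∀ s ∈ Icc (0 : ℝ) 1, g s ≠ 0 := by
    intro s hs
    have hn : ‖-(s • B)‖ < 1 := by
      rw [norm_neg, norm_smul, Real.norm_of_nonneg hs.1]
      nlinarith [hs.2, norm_nonneg B, hs.1]
    have hu : IsUnit (1 - -(s • B)) := isUnit_one_sub_of_norm_lt_one hn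
    rw [sub_neg_eq_add] at hu
    have : IsUnit ((1 + s • B : (𝔼 d) →L[ℝ] 𝔼 d).toLinearMap) :=
      hu.map (ContinuousLinearMap.toLinearMapRingHom (R₁ := ℝ) (M₁ := 𝔼 d))
    exact (LinearMap.isUnit_iff_isUnit_det _).1 this |>.ne_zero
  have h0 : g 0 = 1 := by simp [hg, ContinuousLinearMap.det]
  have h1 : g 1 = (ContinuousLinearMap.id ℝ (𝔼 d) + B).det := by simp [hg]
  rw [← h1]
  by_contra hcon
  push Not at hcon
  obtain ⟨s, hs, hs0⟩ := intermediate_value_Icc' zero_le_one hcont.continuousOn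
    (show (0 : ℝ) ∈ Icc (g 1) (g 0) from ⟨hcon, by rw [h0]; exact zero_le_one⟩)
  exact hne s hs hs0

/-- A small compactly supported `C¹` perturbation of the identity preserves the volume of any
ball containing the support of the perturbation. -/
theorem setIntegral_det_id_add_fderiv (V : (𝔼 d) → 𝔼 d) (hV : ContDiff ℝ 1 V) {K : ℝ≥0}
    (hK : K < 1) (hlip : LipschitzWith K V) {r : ℝ} (hr : ∀ x, x ∉ Metric.closedBall 0 r → V x = 0) :
    ∫ x in Metric.closedBall (0 : 𝔼 d) r, (ContinuousLinearMap.id ℝ (𝔼 d) + fderiv ℝ V x).det =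
      volume.real (Metric.closedBall (0 : 𝔼 d) r) := by
  set s := Metric.closedBall (0 : 𝔼 d) r
  set g : (𝔼 d) → 𝔼 d := fun x => x + V x with hg
  have hder : ∀ x, HasFDerivAt g (ContinuousLinearMap.id ℝ (𝔼 d) + fderiv ℝ V x) x := fun x =>
    (hasFDerivAt_id x).add (hV.differentiable one_ne_zero x).hasFDerivAt
  have hinj : Function.Injective g := by
    intro x y hxy
    have h1 : dist x y = dist (V x) (V y) := by
      rw [dist_eq_norm, dist_eq_norm, ← norm_neg]
      congr 1
      simp only [hg] at hxy
      rw [neg_sub, sub_eq_sub_iff_add_eq_add, hxy.symm, add_comm]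
    have h2 := hlip.dist_le_mul x y
    have hK' : (K : ℝ) < 1 := hK
    have : dist x y = 0 := by nlinarith [dist_nonneg (x := x) (y := y)]
    exact dist_eq_zero.1 this
  have hsurj : Function.Surjective g := by
    intro y
    have hc : ContractingWith K (fun x => y - V x) :=
      ⟨hK, LipschitzWith.of_dist_le_mul fun a b => by
        simpa only [dist_sub_left] using hlip.dist_le_mul a b⟩
    refine ⟨hc.fixedPoint, ?_⟩
    have := hc.fixedPoint_isFixedPt
    simp only [Function.IsFixedPt] at this
    simp only [hg]
    nth_rewrite 1 [← this]
    simp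
  have himage : g '' s = s := by
    have hcompl : g '' sᶜ = sᶜ := by
      have : EqOn g id sᶜ := fun x hx => by simp [hg, hr x hx]
      rw [this.image_eq, image_id]
    have := image_compl_eq (s := s) (⟨hinj, hsurj⟩ : Function.Bijective g)
    rw [hcompl] at this
    exact (compl_injective this).symm
  have hcv := integral_image_eq_integral_abs_det_fderiv_smul volume
    (Metric.isClosed_closedBall (x := (0 : 𝔼 d)) (ε := r)).measurableSet
    (fun x _ => (hder x).hasFDerivWithinAt) hinj.injOn (fun _ => (1 : ℝ))
  rw [himage] at hcv
  simp only [smul_eq_mul, mul_one, integral_const, measureReal_restrict_apply_univ] at hcv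
  rw [hcv]
  refine integral_congr_ae (Eventually.of_forall fun x => ?_)
  have hn : ‖fderiv ℝ V x‖ < 1 :=
    lt_of_le_of_lt (norm_fderiv_le_of_lipschitz ℝ hlip) hK
  exact (abs_of_pos (ContinuousLinearMap.det_id_add_pos_of_norm_lt_one _ hn)).symm

/-- The Jacobian determinant of a compactly supported `C¹` map has zero integral. -/
theorem integral_det_fderiv_eq_zero (hd : d ≠ 0) (W : (𝔼 d) → 𝔼 d) (hW : ContDiff ℝ 1 W)
    (hsupp : HasCompactSupport W) : ∫ x, (fderiv ℝ W x).det = 0 := by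
  obtain ⟨C, hC⟩ := ContDiff.lipschitzWith_of_hasCompactSupport hsupp hW one_ne_zero
  obtain ⟨r, hr⟩ := hsupp.isCompact.isBounded.subset_closedBall (0 : 𝔼 d)
  set s := Metric.closedBall (0 : 𝔼 d) r with hs
  have hout : ∀ x, x ∉ s → W x = 0 := fun x hx =>
    image_eq_zero_of_notMem_tsupport fun h => hx (hr h)
  set τ : ℝ≥0 := ((d : ℝ≥0) * C + 1)⁻¹ with hτ
  have hτpos : 0 < τ := by positivity
  have hkey : ∀ k ∈ Finset.range (d + 1),
      ∫ x in s, (ContinuousLinearMap.id ℝ (𝔼 d) + (k : ℝ) • ((τ : ℝ) • fderiv ℝ W x)).det =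
        volume.real s := by
    intro k hk
    have hkd : (k : ℝ≥0) ≤ d := by exact_mod_cast Finset.mem_range_succ_iff.1 hk
    have hlip : LipschitzWith ((k * τ) * C) (fun x => ((k * τ : ℝ≥0) : ℝ) • W x) := by
      refine LipschitzWith.of_dist_le_mul fun a b => ?_
      rw [dist_smul₀, Real.norm_of_nonneg (NNReal.coe_nonneg _), NNReal.coe_mul _ C, mul_assoc]
      exact mul_le_mul_of_nonneg_left (hC.dist_le_mul a b) (NNReal.coe_nonneg _)
    have hlt : k * τ * C < 1 := by
      rw [hτ, mul_right_comm, ← div_eq_mul_inv, div_lt_one (by positivity)]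
      exact lt_of_le_of_lt (mul_le_mul' hkd le_rfl) (lt_add_one _)
    have := setIntegral_det_id_add_fderiv _ (hW.const_smul ((k * τ : ℝ≥0) : ℝ)) hlt hlip (r := r)
      (fun x hx => by simp [hout x hx])
    rw [← this]
    refine integral_congr_ae (Eventually.of_forall fun x => ?_)
    simp only
    rw [fderiv_fun_const_smul (hW.differentiable one_ne_zero x), smul_smul]
    simp
  have hcontW : Continuous (fderiv ℝ W) := hW.continuous_fderiv one_ne_zero
  have hsum : ∫ x in s, (d.factorial : ℝ) * ((τ : ℝ) • fderiv ℝ W x).det = 0 := by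
    have hint : ∀ k ∈ Finset.range (d + 1), Integrable (fun x =>
        ((-1 : ℝ) ^ (d - k) * d.choose k) *
        (ContinuousLinearMap.id ℝ (𝔼 d) + (k : ℝ) • ((τ : ℝ) • fderiv ℝ W x)).det)
        (volume.restrict s) := by
      intro k _
      refine (Continuous.continuousOn ?_).integrableOn_compact (isCompact_closedBall _ _)
      have h1 : Continuous fun x => (ContinuousLinearMap.id ℝ (𝔼 d) +
        (k : ℝ) • ((τ : ℝ) • fderiv ℝ W x)).det :=
        ContinuousLinearMap.continuous_det.comp (by fun_prop)
      exact continuous_const.mul h1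
    simp_rw [← ContinuousLinearMap.sum_choose_smul_det_one_add]
    rw [integral_finsetSum _ hint]
    have hzero := ContinuousLinearMap.sum_choose_smul_det_one_add (0 : (𝔼 d) →L[ℝ] 𝔼 d)
    have hdet0 : (0 : (𝔼 d) →L[ℝ] 𝔼 d).det = 0 := by
      rw [ContinuousLinearMap.det_eq_det_matrix]
      have : Nonempty (Fin d) := ⟨⟨0, Nat.pos_of_ne_zero hd⟩⟩
      exact Matrix.det_zero
    have hdet1 : (ContinuousLinearMap.id ℝ (𝔼 d)).det = 1 := by simp [ContinuousLinearMap.det]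
    have hid (k : ℕ) : ContinuousLinearMap.id ℝ (𝔼 d) + (k : ℝ) • (0 : (𝔼 d) →L[ℝ] 𝔼 d) =
        ContinuousLinearMap.id ℝ (𝔼 d) := by
      ext; simp
    simp only [hid, hdet0, hdet1, mul_zero, mul_one] at hzero
    calc _ = ∑ k ∈ Finset.range (d + 1), ((-1 : ℝ) ^ (d - k) * d.choose k) *
          volume.real s := by
          refine Finset.sum_congr rfl fun k hk => ?_
          rw [← hkey k hk, integral_const_mul]
      _ = 0 := by rw [← Finset.sum_mul, hzero, zero_mul]
  have hscale : ∀ x, (d.factorial : ℝ) * ((τ : ℝ) • fderiv ℝ W x).det =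
      (d.factorial * (τ : ℝ) ^ d) * (fderiv ℝ W x).det := by
    intro x
    have : ((τ : ℝ) • fderiv ℝ W x).det = (τ : ℝ) ^ d * (fderiv ℝ W x).det := by
      simp [ContinuousLinearMap.det]
    rw [this, mul_assoc]
  simp_rw [hscale] at hsum
  rw [integral_const_mul] at hsum
  have hne : (d.factorial * (τ : ℝ) ^ d : ℝ) ≠ 0 := by positivity
  rw [← setIntegral_eq_integral_of_forall_compl_eq_zero (s := s)]
  · exact (mul_eq_zero.1 hsum).resolve_left hne
  · intro x hx
    have hx' : x ∉ tsupport W := fun h => hx (hr h)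
    have : fderiv ℝ W x = 0 := by
      have h2 : x ∉ tsupport (fderiv ℝ W) := fun h => hx' (tsupport_fderiv_subset ℝ h)
      exact image_eq_zero_of_notMem_tsupport h2
    rw [this, ContinuousLinearMap.det_eq_det_matrix]
    have : Nonempty (Fin d) := ⟨⟨0, Nat.pos_of_ne_zero hd⟩⟩
    exact Matrix.det_zero

/-- The Jacobian matrix of a family of `d` scalar functions on `ℝᵈ`. -/
def jacobianMatrix (F : Fin d → (𝔼 d) → ℝ) (x : 𝔼 d) : Matrix (Fin d) (Fin d) ℝ :=
  Matrix.of fun i j => fderiv ℝ (F i) x (EuclideanSpace.single j 1)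

theorem fderiv_apply_coord {u : (𝔼 d) → 𝔼 d} {x : 𝔼 d} (hu : DifferentiableAt ℝ u x)
    (v : 𝔼 d) (i : Fin d) : fderiv ℝ (fun y => u y i) x v = fderiv ℝ u x v i := by
  have h := hasFDerivWithinAt_euclidean.1 (hu.hasFDerivAt.hasFDerivWithinAt (s := univ)) i
  rw [hasFDerivWithinAt_univ] at h
  rw [h.fderiv]
  rfl

theorem det_fderiv_eq_det_jacobianMatrix {u : (𝔼 d) → 𝔼 d} {x : 𝔼 d}
    (hu : DifferentiableAt ℝ u x) :
    (fderiv ℝ u x).det = (jacobianMatrix (fun i y => u y i) x).det := by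
  rw [ContinuousLinearMap.det_eq_det_matrix]
  congr 1
  ext i j
  exact (fderiv_apply_coord hu _ _).symm

theorem jacobianMatrix_update (F : Fin d → (𝔼 d) → ℝ) (k : Fin d) (w : (𝔼 d) → ℝ) (x : 𝔼 d) :
    jacobianMatrix (Function.update F k w) x =
      (jacobianMatrix F x).updateRow k fun j => fderiv ℝ w x (EuclideanSpace.single j 1) := by
  ext i j
  by_cases h : i = k
  · subst h; simp [jacobianMatrix]
  · simp [jacobianMatrix, h]

theorem continuousOn_det_jacobianMatrix {F : Fin d → (𝔼 d) → ℝ} {Ω : Set (𝔼 d)} (hΩ : IsOpen Ω)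
    (hF : ∀ i, ContDiffOn ℝ 1 (F i) Ω) : ContinuousOn (fun x => (jacobianMatrix F x).det) Ω := by
  have hM : ContinuousOn (jacobianMatrix F) Ω := by
    refine continuousOn_pi.2 fun i => continuousOn_pi.2 fun j => ?_
    exact ((hF i).continuousOn_fderiv_of_isOpen hΩ le_rfl).clm_apply continuousOn_const
  exact (continuous_id.matrix_det).comp_continuousOn hM

theorem contDiff_mul_of_tsupport_subset {φ w : (𝔼 d) → ℝ} {Ω : Set (𝔼 d)} (hΩ : IsOpen Ω)
    (hφ : ContDiff ℝ 1 φ) (hsub : tsupport φ ⊆ Ω) (hw : ContDiffOn ℝ 1 w Ω) :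
    ContDiff ℝ 1 fun x => φ x * w x := by
  rw [contDiff_iff_contDiffAt]
  intro x
  by_cases hx : x ∈ tsupport φ
  · exact hφ.contDiffAt.mul (hw.contDiffAt (hΩ.mem_nhds (hsub hx)))
  · have h0 : (fun x => φ x * w x) =ᶠ[𝓝 x] fun _ => 0 := by
      filter_upwards [notMem_tsupport_iff_eventuallyEq.1 hx] with y hy
      simp [hy]
    exact contDiffAt_const.congr_of_eventuallyEq h0

theorem integrable_mul_of_tsupport_subset {φ g : (𝔼 d) → ℝ} {Ω : Set (𝔼 d)}
    (hφ : Continuous φ) (hc : HasCompactSupport φ) (hsub : tsupport φ ⊆ Ω)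
    (hg : ContinuousOn g Ω) : Integrable fun x => φ x * g x := by
  rw [← integrableOn_iff_integrable_of_support_subset (s := tsupport φ)]
  · exact (hφ.continuousOn.mul (hg.mono hsub)).integrableOn_compact hc
  · exact (Function.support_mul_subset_left _ _).trans (subset_tsupport φ)

/-- The Jacobian determinant of a family of compactly supported `C¹` functions has zero
integral. -/
theorem integral_det_jacobianMatrix_eq_zero (hd : d ≠ 0) (G : Fin d → (𝔼 d) → ℝ)
    (hG : ∀ i, ContDiff ℝ 1 (G i)) (hc : ∀ i, HasCompactSupport (G i)) :
    ∫ x, (jacobianMatrix G x).det = 0 := by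
  set W : (𝔼 d) → 𝔼 d := fun x => WithLp.toLp 2 fun i => G i x with hW
  have hWd : ContDiff ℝ 1 W := contDiff_euclidean.2 hG
  have hWc : HasCompactSupport W := by
    refine HasCompactSupport.of_support_subset_isCompact (isCompact_iUnion fun i => hc i)
      fun x hx => ?_
    by_contra hcon
    simp only [mem_iUnion, not_exists] at hcon
    refine hx ?_
    ext i
    exact image_eq_zero_of_notMem_tsupport (f := G i) (hcon i)
  rw [← integral_det_fderiv_eq_zero hd W hWd hWc]
  refine integral_congr_ae (Eventually.of_forall fun x => ?_)
  exact (det_fderiv_eq_det_jacobianMatrix (hWd.differentiable one_ne_zero x)).symm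

/-- Integration by parts in one row of a Jacobian determinant. -/
theorem integral_mul_det_jacobianMatrix_update (hd : d ≠ 0) {φ χ : (𝔼 d) → ℝ} {Ω : Set (𝔼 d)}
    (hΩ : IsOpen Ω) (hφ : ContDiff ℝ 1 φ) (hφc : HasCompactSupport φ) (hχ : ContDiff ℝ 1 χ)
    (hχc : HasCompactSupport χ) (hχΩ : tsupport χ ⊆ Ω) (hφχ : ∀ x ∈ tsupport φ, χ =ᶠ[𝓝 x] 1)
    {F : Fin d → (𝔼 d) → ℝ} (hF : ∀ i, ContDiffOn ℝ 1 (F i) Ω) {w : (𝔼 d) → ℝ}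
    (hw : ContDiffOn ℝ 1 w Ω) (k : Fin d) :
    ∫ x, φ x * (jacobianMatrix (Function.update F k w) x).det =
      -∫ x, w x * (jacobianMatrix (Function.update F k φ) x).det := by
  have hφΩ : tsupport φ ⊆ Ω := fun x hx => hχΩ (subset_tsupport χ (by
    have := (hφχ x hx).eq_of_nhds
    simp [this]))
  set G : Fin d → (𝔼 d) → ℝ :=
    Function.update (fun i x => χ x * F i x) k (fun x => φ x * w x) with hG
  have hGd : ∀ i, ContDiff ℝ 1 (G i) := by
    intro i
    by_cases h : i = k
    · subst h
      simpa [hG] using contDiff_mul_of_tsupport_subset hΩ hφ hφΩ hw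
    · simpa [hG, h] using contDiff_mul_of_tsupport_subset hΩ hχ hχΩ (hF i)
  have hGc : ∀ i, HasCompactSupport (G i) := by
    intro i
    by_cases h : i = k
    · subst h
      simpa [hG] using! hφc.mul_right (f' := w)
    · simpa [hG, h] using! hχc.mul_right (f' := F i)
  have hpt : ∀ x, (jacobianMatrix G x).det =
      φ x * (jacobianMatrix (Function.update F k w) x).det +
        w x * (jacobianMatrix (Function.update F k φ) x).det := by
    intro x
    by_cases hx : x ∈ tsupport φ
    · have hdw : DifferentiableAt ℝ w x :=
        (hw.contDiffAt (hΩ.mem_nhds (hφΩ hx))).differentiableAt one_ne_zero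
      have hdφ : DifferentiableAt ℝ φ x := hφ.differentiable one_ne_zero x
      have hrow : (fun j => fderiv ℝ (fun x => φ x * w x) x (EuclideanSpace.single j 1)) =
          φ x • (fun j => fderiv ℝ w x (EuclideanSpace.single j 1)) +
            w x • fun j => fderiv ℝ φ x (EuclideanSpace.single j 1) := by
        ext j
        rw [fderiv_fun_mul hdφ hdw]
        simp
      have hsame : (jacobianMatrix G x) = (jacobianMatrix F x).updateRow k
          fun j => fderiv ℝ (fun x => φ x * w x) x (EuclideanSpace.single j 1) := by
        rw [hG, jacobianMatrix_update]
        ext i j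
        by_cases h : i = k
        · subst h; simp
        · simp only [ne_eq, h, not_false_eq_true, Matrix.updateRow_ne]
          have : (fun x => χ x * F i x) =ᶠ[𝓝 x] F i := by
            filter_upwards [hφχ x hx] with y hy
            simp [hy]
          simp only [jacobianMatrix, Matrix.of_apply]
          rw [this.fderiv_eq]
      rw [hsame, hrow, Matrix.det_updateRow_add, Matrix.det_updateRow_smul,
        Matrix.det_updateRow_smul, jacobianMatrix_update, jacobianMatrix_update]
    · have hφ0 : φ =ᶠ[𝓝 x] 0 := notMem_tsupport_iff_eventuallyEq.1 hx
      have h1 : (jacobianMatrix G x).det = 0 := by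
        refine Matrix.det_eq_zero_of_row_eq_zero k fun j => ?_
        have : (fun x => φ x * w x) =ᶠ[𝓝 x] fun _ => 0 := by
          filter_upwards [hφ0] with y hy
          simp [hy]
        simp [jacobianMatrix, hG, this.fderiv_eq]
      have h2 : (jacobianMatrix (Function.update F k φ) x).det = 0 := by
        refine Matrix.det_eq_zero_of_row_eq_zero k fun j => ?_
        have h3 : fderiv ℝ φ x = 0 := by
          rw [hφ0.fderiv_eq]; simp
        simp [jacobianMatrix, h3]
      rw [h1, h2, hφ0.eq_of_nhds]
      simp
  have hw' : ∀ x, w x * (jacobianMatrix (Function.update F k φ) x).det =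
      (jacobianMatrix G x).det - φ x * (jacobianMatrix (Function.update F k w) x).det := by
    intro x
    rw [hpt x]; ring
  have hFw : ∀ i, ContDiffOn ℝ 1 (Function.update F k w i) Ω := by
    intro i
    by_cases h : i = k
    · subst h; simpa using hw
    · simpa [h] using hF i
  have hint1 : Integrable fun x => φ x * (jacobianMatrix (Function.update F k w) x).det :=
    integrable_mul_of_tsupport_subset hφ.continuous hφc hφΩ
      (continuousOn_det_jacobianMatrix hΩ hFw)
  have hint2 : Integrable fun x => (jacobianMatrix G x).det := by
    refine Continuous.integrable_of_hasCompactSupport ?_ ?_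
    · exact continuousOn_univ.1
        (continuousOn_det_jacobianMatrix isOpen_univ fun i => (hGd i).contDiffOn)
    · refine HasCompactSupport.of_support_subset_isCompact hφc fun x hx => ?_
      by_contra hcon
      refine hx (Matrix.det_eq_zero_of_row_eq_zero k fun j => ?_)
      have hφ0 : φ =ᶠ[𝓝 x] 0 := notMem_tsupport_iff_eventuallyEq.1 hcon
      have : (fun x => φ x * w x) =ᶠ[𝓝 x] fun _ => 0 := by
        filter_upwards [hφ0] with y hy
        simp [hy]
      simp [jacobianMatrix, hG, this.fderiv_eq]
  simp_rw [hw']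
  rw [integral_sub hint2 hint1, integral_det_jacobianMatrix_eq_zero hd G hGd hGc]
  ring

theorem abs_jacobianMatrix_le {u : (𝔼 d) → 𝔼 d} {x : 𝔼 d} (hu : DifferentiableAt ℝ u x)
    (i j : Fin d) : |jacobianMatrix (fun i y => u y i) x i j| ≤ ‖fderiv ℝ u x‖ := by
  simp only [jacobianMatrix, Matrix.of_apply]
  rw [fderiv_apply_coord hu, ← Real.norm_eq_abs]
  refine (PiLp.norm_apply_le _ i).trans ?_
  simpa using (fderiv ℝ u x).le_opNorm (EuclideanSpace.single j 1)

/-- Weighted averages of the Jacobian determinant depend on the map continuously with respect to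
the `L¹` distance, uniformly on sets of maps with bounded derivative. -/
theorem exists_abs_integral_det_sub_le (hd : d ≠ 0) {φ χ : (𝔼 d) → ℝ}
    (hφ : ContDiff ℝ 1 φ) (hφc : HasCompactSupport φ) (hχ : ContDiff ℝ 1 χ)
    (hχc : HasCompactSupport χ) (hφχ : ∀ x ∈ tsupport φ, χ =ᶠ[𝓝 x] 1) (L : ℝ) :
    ∃ C : ℝ, 0 < C ∧ ∀ (Ω : Set (𝔼 d)) (U V : (𝔼 d) → 𝔼 d), IsOpen Ω → tsupport χ ⊆ Ω →
      ContDiffOn ℝ 1 U Ω → ContDiffOn ℝ 1 V Ω →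
      (∀ x ∈ tsupport φ, ‖fderiv ℝ U x‖ ≤ L) → (∀ x ∈ tsupport φ, ‖fderiv ℝ V x‖ ≤ L) →
      |∫ x, φ x * ((fderiv ℝ U x).det - (fderiv ℝ V x).det)| ≤
        C * ∫ x in tsupport φ, ‖U x - V x‖ := by
  obtain ⟨G, hG⟩ := (hφc.fderiv ℝ).exists_bound_of_continuous (hφ.continuous_fderiv one_ne_zero)
  set B : ℝ := max (max L G) 1 with hB
  have hLB : L ≤ B := (le_max_left _ _).trans (le_max_left _ _)
  have hGB : G ≤ B := (le_max_right _ _).trans (le_max_left _ _)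
  have hBpos : 0 < B := lt_of_lt_of_le one_pos (le_max_right _ _)
  set C₀ : ℝ := d.factorial * B ^ d with hC₀
  have hC₀pos : 0 < C₀ := by positivity
  refine ⟨d * C₀, by have := Nat.pos_of_ne_zero hd; positivity, ?_⟩
  intro Ω U V hΩ hχΩ hU hV hUL hVL
  have hφΩ : tsupport φ ⊆ Ω := fun x hx => hχΩ (subset_tsupport χ (by
    have := (hφχ x hx).eq_of_nhds
    simp [this]))
  have hUd : ∀ x ∈ Ω, DifferentiableAt ℝ U x := fun x hx =>
    (hU.contDiffAt (hΩ.mem_nhds hx)).differentiableAt one_ne_zero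
  have hVd : ∀ x ∈ Ω, DifferentiableAt ℝ V x := fun x hx =>
    (hV.contDiffAt (hΩ.mem_nhds hx)).differentiableAt one_ne_zero
  set FU : Fin d → (𝔼 d) → ℝ := fun i y => U y i with hFU
  set FV : Fin d → (𝔼 d) → ℝ := fun i y => V y i with hFV
  have hFUd : ∀ i, ContDiffOn ℝ 1 (FU i) Ω := contDiffOn_euclidean.1 hU
  have hFVd : ∀ i, ContDiffOn ℝ 1 (FV i) Ω := contDiffOn_euclidean.1 hV
  have hIint : IntegrableOn (fun x => ‖U x - V x‖) (tsupport φ) :=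
    ((hU.continuousOn.sub hV.continuousOn).norm.mono hφΩ).integrableOn_compact hφc
  set I : ℝ := ∫ x in tsupport φ, ‖U x - V x‖ with hI
  have hmixed (T : Finset (Fin d)) : ∀ i, ContDiffOn ℝ 1 (T.piecewise FU FV i) Ω := by
    intro i
    by_cases h : i ∈ T
    · simpa [h] using hFUd i
    · simpa [h] using hFVd i
  have hint (T : Finset (Fin d)) :
      Integrable fun x => φ x * (jacobianMatrix (T.piecewise FU FV) x).det :=
    integrable_mul_of_tsupport_subset hφ.continuous hφc hφΩ
      (continuousOn_det_jacobianMatrix hΩ (hmixed T))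
  have hstep : ∀ T : Finset (Fin d),
      |(∫ x, φ x * (jacobianMatrix (T.piecewise FU FV) x).det) -
        ∫ x, φ x * (jacobianMatrix FV x).det| ≤ T.card * (C₀ * I) := by
    intro T
    induction T using Finset.induction_on with
    | empty => simp
    | insert k T hk ih =>
      set F := T.piecewise FU FV with hF
      have hdiff : (∫ x, φ x * (jacobianMatrix ((insert k T).piecewise FU FV) x).det) -
          (∫ x, φ x * (jacobianMatrix F x).det) =
          ∫ x, φ x * (jacobianMatrix (Function.update F k fun x => FU k x - FV k x) x).det := by
        rw [← integral_sub (hint _) (hint T)]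
        refine integral_congr_ae (Eventually.of_forall fun x => ?_)
        simp only
        by_cases hx : x ∈ tsupport φ
        · rw [← mul_sub]
          congr 1
          rw [Finset.piecewise_insert, ← hF]
          have hFk : F = Function.update F k (FV k) := by
            rw [eq_comm, Function.update_eq_self_iff, hF]
            simp [hk]
          have hrow : (fun j => fderiv ℝ (FU k) x (EuclideanSpace.single j 1)) =
              (fun j => fderiv ℝ (FV k) x (EuclideanSpace.single j 1)) +
              (fun j => fderiv ℝ (fun x => FU k x - FV k x) x (EuclideanSpace.single j 1)) := by
            ext j
            have h1 : DifferentiableAt ℝ (FU k) x :=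
              ((hFUd k).contDiffAt (hΩ.mem_nhds (hφΩ hx))).differentiableAt one_ne_zero
            have h2 : DifferentiableAt ℝ (FV k) x :=
              ((hFVd k).contDiffAt (hΩ.mem_nhds (hφΩ hx))).differentiableAt one_ne_zero
            rw [Pi.add_apply, fderiv_fun_sub h1 h2]
            simp
          have h1 := jacobianMatrix_update F k (FV k) x
          rw [← hFk] at h1
          rw [jacobianMatrix_update, hrow, Matrix.det_updateRow_add, ← h1, jacobianMatrix_update]
          ring
        · simp [image_eq_zero_of_notMem_tsupport hx]
      have hw : ContDiffOn ℝ 1 (fun x => FU k x - FV k x) Ω := (hFUd k).sub (hFVd k)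
      have hbound : |∫ x, φ x *
          (jacobianMatrix (Function.update F k fun x => FU k x - FV k x) x).det| ≤ C₀ * I := by
        rw [integral_mul_det_jacobianMatrix_update hd hΩ hφ hφc hχ hχc hχΩ hφχ (hmixed T) hw k,
          abs_neg]
        rw [← setIntegral_eq_integral_of_forall_compl_eq_zero (s := tsupport φ), hI,
          ← integral_const_mul, ← Real.norm_eq_abs]
        · refine norm_integral_le_of_norm_le (hIint.const_mul C₀) ?_
          filter_upwards [ae_restrict_mem (isClosed_tsupport φ).measurableSet] with x hx
          rw [norm_mul, mul_comm]
          have hentry : ∀ i j, AbsoluteValue.abs (jacobianMatrix (Function.update F k φ) x i j)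
              ≤ B := by
            intro i j
            rw [AbsoluteValue.abs_apply]
            by_cases h : i = k
            · subst h
              simp only [jacobianMatrix, Matrix.of_apply, Function.update_self]
              refine le_trans ?_ ((hG x).trans hGB)
              simpa using (fderiv ℝ φ x).le_opNorm (EuclideanSpace.single j 1)
            · simp only [jacobianMatrix, Matrix.of_apply, ne_eq, h, not_false_eq_true,
                Function.update_of_ne, hF]
              by_cases hT : i ∈ T
              · simp only [hT, Finset.piecewise_eq_of_mem]
                exact (abs_jacobianMatrix_le (hUd x (hφΩ hx)) i j).trans ((hUL x hx).trans hLB)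
              · simp only [hT, not_false_eq_true, Finset.piecewise_eq_of_notMem]
                exact (abs_jacobianMatrix_le (hVd x (hφΩ hx)) i j).trans ((hVL x hx).trans hLB)
          have hdet := Matrix.det_le hentry
          rw [AbsoluteValue.abs_apply, Fintype.card_fin, nsmul_eq_mul] at hdet
          refine mul_le_mul hdet ?_ (norm_nonneg _) hC₀pos.le
          exact PiLp.norm_apply_le (U x - V x) k
        · intro x hx
          have hφ0 : φ =ᶠ[𝓝 x] 0 := notMem_tsupport_iff_eventuallyEq.1 hx
          have h3 : fderiv ℝ φ x = 0 := by
            rw [hφ0.fderiv_eq]; simp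
          have : (jacobianMatrix (Function.update F k φ) x).det = 0 :=
            Matrix.det_eq_zero_of_row_eq_zero k fun j => by simp [jacobianMatrix, h3]
          exact mul_eq_zero_of_right _ this
      rw [← hdiff] at hbound
      rw [Finset.card_insert_of_notMem hk]
      push_cast
      refine (abs_sub_le _ (∫ x, φ x * (jacobianMatrix F x).det) _).trans ?_
      linarith
  have hfin := hstep Finset.univ
  rw [Finset.piecewise_univ, Finset.card_univ, Fintype.card_fin, ← mul_assoc] at hfin
  refine le_trans (le_of_eq ?_) hfin
  have hintU := hint Finset.univ
  have hintV := hint ∅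
  rw [Finset.piecewise_univ] at hintU
  rw [Finset.piecewise_empty] at hintV
  rw [← integral_sub hintU hintV]
  congr 1
  refine integral_congr_ae (Eventually.of_forall fun x => ?_)
  simp only
  by_cases hx : x ∈ tsupport φ
  · rw [det_fderiv_eq_det_jacobianMatrix (hUd x (hφΩ hx)),
      det_fderiv_eq_det_jacobianMatrix (hVd x (hφΩ hx)), mul_sub]
  · simp [image_eq_zero_of_notMem_tsupport hx]

theorem convex_unitCube : Convex ℝ (unitCube d) := by
  intro x hx y hy a b ha hb hab i
  have := convex_Icc (0 : ℝ) 1 (hx i) (hy i) ha hb hab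
  simpa using this

theorem isCompact_unitCube : IsCompact (unitCube d) := by
  have hc : IsCompact (Set.pi univ fun _ : Fin d => Icc (0 : ℝ) 1) :=
    isCompact_univ_pi fun _ => isCompact_Icc
  have := hc.image (PiLp.continuous_toLp 2 fun _ : Fin d => ℝ)
  convert this using 1
  ext x
  constructor
  · intro hx
    exact ⟨x.ofLp, fun i _ => hx i, rfl⟩
  · rintro ⟨y, hy, rfl⟩ i
    exact hy i (mem_univ i)

theorem measurableSet_unitCube : MeasurableSet (unitCube d) :=
  isCompact_unitCube.isClosed.measurableSet

/-- A pair of nested cutoff functions supported in the unit cube, the inner one having a positive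
first half-wave sine moment. -/
theorem exists_nested_bumps (i₀ : Fin d) : ∃ φ χ : (𝔼 d) → ℝ,
    ContDiff ℝ 1 φ ∧ HasCompactSupport φ ∧ ContDiff ℝ 1 χ ∧ HasCompactSupport χ ∧
    (∀ x ∈ tsupport φ, χ =ᶠ[𝓝 x] 1) ∧ tsupport φ ⊆ unitCube d ∧ tsupport χ ⊆ unitCube d ∧
    (∀ x, 0 ≤ φ x) ∧ (∀ x, φ x ≤ 1) ∧ 0 < ∫ x, φ x * Real.sin (Real.pi * x i₀) := by
  set c : 𝔼 d := WithLp.toLp 2 fun _ => 1 / 2 with hc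
  let φ : ContDiffBump c := ⟨1 / 8, 1 / 4, by norm_num, by norm_num⟩
  let χ : ContDiffBump c := ⟨1 / 3, 2 / 5, by norm_num, by norm_num⟩
  have hball : ∀ r : ℝ, r ≤ 1 / 2 → Metric.closedBall c r ⊆ unitCube d := by
    intro r hr x hx i
    have h1 : |x i - 1 / 2| ≤ r := by
      have := (PiLp.norm_apply_le (x - c) i).trans (mem_closedBall_iff_norm.1 hx)
      simpa [hc] using this
    rw [abs_le] at h1
    constructor <;> linarith
  have hφs : tsupport φ ⊆ unitCube d := by
    rw [φ.tsupport_eq]; exact hball _ (by norm_num [φ])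
  have hχs : tsupport χ ⊆ unitCube d := by
    rw [χ.tsupport_eq]; exact hball _ (by norm_num [χ])
  refine ⟨φ, χ, φ.contDiff, φ.hasCompactSupport, χ.contDiff, χ.hasCompactSupport, ?_, hφs, hχs,
    fun x => φ.nonneg, fun x => φ.le_one, ?_⟩
  · intro x hx
    rw [φ.tsupport_eq] at hx
    refine χ.eventuallyEq_one_of_mem_ball ?_
    have : dist x c ≤ 1 / 4 := hx
    rw [Metric.mem_ball]
    exact this.trans_lt (by norm_num [χ])
  · have hcont : Continuous fun x : 𝔼 d => φ x * Real.sin (Real.pi * x i₀) :=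
      φ.continuous.mul (by fun_prop)
    refine hcont.integral_pos_of_hasCompactSupport_nonneg_nonzero (x := c) ?_ ?_ ?_
    · exact φ.hasCompactSupport.mul_right
    · intro x
      by_cases hx : x ∈ tsupport φ
      · have h := hφs hx i₀
        exact mul_nonneg φ.nonneg (Real.sin_nonneg_of_nonneg_of_le_pi
          (mul_nonneg Real.pi_pos.le h.1) (by nlinarith [h.2, Real.pi_pos]))
      · simp [image_eq_zero_of_notMem_tsupport hx]
    · have h1 : φ c = 1 := φ.one_of_mem_closedBall (by simp [φ])
      have h2 : Real.pi * c i₀ = Real.pi / 2 := by simp [hc]; ring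
      simp only [h1, h2, Real.sin_pi_div_two]
      norm_num

/-- A `C¹` solution of the prescribed Jacobian equation `det Du = f` on the unit cube with
derivative bounded by `L`. -/
structure IsJacobianSolution (L : ℝ) (f : (𝔼 d) → ℝ) (u : (𝔼 d) → 𝔼 d) : Prop where
  contDiffOn : ∃ O, IsOpen O ∧ unitCube d ⊆ O ∧ ContDiffOn ℝ 1 u O
  det_eq : ∀ x ∈ unitCube d, (fderiv ℝ u x).det = f x
  norm_fderiv_le : ∀ x ∈ unitCube d, ‖fderiv ℝ u x‖ ≤ L

theorem IsJacobianSolution.differentiableAt {L : ℝ} {f : (𝔼 d) → ℝ} {u : (𝔼 d) → 𝔼 d}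
    (hu : IsJacobianSolution L f u) {x : 𝔼 d} (hx : x ∈ unitCube d) : DifferentiableAt ℝ u x := by
  obtain ⟨O, hO, hsub, hcd⟩ := hu.contDiffOn
  exact (hcd.contDiffAt (hO.mem_nhds (hsub hx))).differentiableAt one_ne_zero

theorem IsJacobianSolution.norm_sub_le {L : ℝ} {f : (𝔼 d) → ℝ} {u : (𝔼 d) → 𝔼 d}
    (hu : IsJacobianSolution L f u) {x y : 𝔼 d} (hx : x ∈ unitCube d) (hy : y ∈ unitCube d) :
    ‖u y - u x‖ ≤ L * ‖y - x‖ :=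
  convex_unitCube.norm_image_sub_le_of_norm_fderiv_le (fun _ hz => hu.differentiableAt hz)
    hu.norm_fderiv_le hx hy

theorem fderiv_inv_smul_comp_add_smul {u : (𝔼 d) → 𝔼 d} {h : ℝ} (hh : h ≠ 0) (z v q : 𝔼 d)
    (hu : DifferentiableAt ℝ u (z + h • q)) :
    fderiv ℝ (fun q => h⁻¹ • (u (z + h • q) - v)) q = fderiv ℝ u (z + h • q) := by
  have h1 : HasFDerivAt (fun q : 𝔼 d => z + h • q) (h • ContinuousLinearMap.id ℝ (𝔼 d)) q :=
    ((hasFDerivAt_id q).const_smul h).const_add z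
  have h2 := ((hu.hasFDerivAt.comp q h1).sub_const v).const_smul h⁻¹
  have h3 : h⁻¹ • fderiv ℝ u (z + h • q) ∘SL (h • ContinuousLinearMap.id ℝ (𝔼 d)) =
      fderiv ℝ u (z + h • q) := by
    ext1 w
    simp [smul_smul, hh]
  rw [h3] at h2
  exact h2.fderiv

/-- If consecutive cells in a row of cells of side `h` are mapped nearly to translates of each
other by a common vector `v`, then the oscillation of the Jacobian between consecutive cells is
small. -/
theorem exists_oscillation_le (hd : d ≠ 0) {φ χ : (𝔼 d) → ℝ}
    (hφ : ContDiff ℝ 1 φ) (hφc : HasCompactSupport φ) (hχ : ContDiff ℝ 1 χ)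
    (hχc : HasCompactSupport χ) (hφχ : ∀ x ∈ tsupport φ, χ =ᶠ[𝓝 x] 1)
    (hφQ : tsupport φ ⊆ unitCube d) (hχQ : tsupport χ ⊆ unitCube d) (L : ℝ) :
    ∃ C : ℝ, 0 < C ∧ ∀ (f : (𝔼 d) → ℝ) (u : (𝔼 d) → 𝔼 d), IsJacobianSolution L f u →
      ∀ (N : ℕ) (h κ η : ℝ) (z : ℕ → 𝔼 d) (v : 𝔼 d), 0 < N → 0 < h →
      (∀ i ≤ N, ∀ q ∈ unitCube d, z i + h • q ∈ unitCube d) →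
      (∀ q ∈ unitCube d,
        ∑ i ∈ Finset.range N, ‖u (z (i + 1) + h • q) - u (z i + h • q) - v‖ ≤ N * h * κ) →
      (∀ i < N, η ≤ |∫ q, φ q * (f (z (i + 1) + h • q) - f (z i + h • q))|) →
      η ≤ C * κ := by
  obtain ⟨C, hC, hmain⟩ := exists_abs_integral_det_sub_le hd hφ hφc hχ hχc hφχ L
  set s := volume.real (tsupport φ) with hs
  have hs0 : 0 ≤ s := measureReal_nonneg
  refine ⟨C * s + 1, by positivity, ?_⟩
  intro f u hu N h κ η z v hN hh hz hsum hη
  obtain ⟨O, hO, hQO, huO⟩ := hu.contDiffOn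
  have hcell : ∀ i < N, η ≤ C * ∫ q in tsupport φ,
      h⁻¹ * ‖u (z (i + 1) + h • q) - u (z i + h • q) - v‖ := by
    intro i hi
    set U : (𝔼 d) → 𝔼 d := fun q => h⁻¹ • (u (z (i + 1) + h • q) - v) with hU
    set V : (𝔼 d) → 𝔼 d := fun q => h⁻¹ • (u (z i + h • q) - 0) with hV
    have hcont (j : ℕ) : Continuous fun q : 𝔼 d => z j + h • q := by fun_prop
    have hcd (j : ℕ) : ContDiff ℝ 1 fun q : 𝔼 d => z j + h • q := by fun_prop
    set Ω : Set (𝔼 d) := (fun q => z (i + 1) + h • q) ⁻¹' O ∩ (fun q => z i + h • q) ⁻¹' O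
    have hΩ : IsOpen Ω := (hO.preimage (hcont _)).inter (hO.preimage (hcont _))
    have hQΩ : unitCube d ⊆ Ω := fun q hq =>
      ⟨hQO (hz (i + 1) hi q hq), hQO (hz i hi.le q hq)⟩
    have hUd : ContDiffOn ℝ 1 U Ω :=
      ((huO.comp (hcd (i + 1)).contDiffOn fun q hq => hq.1).sub contDiffOn_const).const_smul h⁻¹
    have hVd : ContDiffOn ℝ 1 V Ω :=
      ((huO.comp (hcd i).contDiffOn fun q hq => hq.2).sub contDiffOn_const).const_smul h⁻¹
    have hfU : ∀ q ∈ unitCube d, fderiv ℝ U q = fderiv ℝ u (z (i + 1) + h • q) := fun q hq =>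
      fderiv_inv_smul_comp_add_smul hh.ne' _ _ _ (hu.differentiableAt (hz (i + 1) hi q hq))
    have hfV : ∀ q ∈ unitCube d, fderiv ℝ V q = fderiv ℝ u (z i + h • q) := fun q hq =>
      fderiv_inv_smul_comp_add_smul hh.ne' _ _ _ (hu.differentiableAt (hz i hi.le q hq))
    have key := hmain Ω U V hΩ (hχQ.trans hQΩ) hUd hVd
      (fun q hq => by rw [hfU q (hφQ hq)]; exact hu.norm_fderiv_le _ (hz (i + 1) hi q (hφQ hq)))
      (fun q hq => by rw [hfV q (hφQ hq)]; exact hu.norm_fderiv_le _ (hz i hi.le q (hφQ hq)))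
    have hleft : ∫ q, φ q * ((fderiv ℝ U q).det - (fderiv ℝ V q).det) =
        ∫ q, φ q * (f (z (i + 1) + h • q) - f (z i + h • q)) := by
      refine integral_congr_ae (Eventually.of_forall fun q => ?_)
      simp only
      by_cases hq : q ∈ tsupport φ
      · have hq' := hφQ hq
        rw [hfU q hq', hfV q hq', hu.det_eq _ (hz (i + 1) hi q hq'),
          hu.det_eq _ (hz i hi.le q hq')]
      · simp [image_eq_zero_of_notMem_tsupport hq]
    rw [hleft] at key
    refine (hη i hi).trans (key.trans (le_of_eq ?_))
    congr 1
    refine integral_congr_ae (Eventually.of_forall fun q => ?_)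
    simp only [hU, hV]
    rw [← smul_sub, norm_smul, Real.norm_of_nonneg (inv_nonneg.2 hh.le)]
    congr 2
    abel
  have hcontu (i : ℕ) (hi : i ≤ N) : ContinuousOn (fun q => u (z i + h • q)) (tsupport φ) :=
    huO.continuousOn.comp (by fun_prop) fun q hq => hQO (hz i hi q (hφQ hq))
  have hint : ∀ i ∈ Finset.range N, IntegrableOn
      (fun q => h⁻¹ * ‖u (z (i + 1) + h • q) - u (z i + h • q) - v‖) (tsupport φ) := by
    intro i hi
    have hi' := Finset.mem_range.1 hi
    refine ContinuousOn.integrableOn_compact hφc.isCompact ?_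
    exact continuousOn_const.mul
      (((hcontu (i + 1) hi').sub (hcontu i hi'.le)).sub continuousOn_const).norm
  have htotal : N * η ≤ C * (N * κ * s) := by
    calc N * η = ∑ i ∈ Finset.range N, η := by simp
      _ ≤ ∑ i ∈ Finset.range N, C * ∫ q in tsupport φ,
          h⁻¹ * ‖u (z (i + 1) + h • q) - u (z i + h • q) - v‖ :=
        Finset.sum_le_sum fun i hi => hcell i (Finset.mem_range.1 hi)
      _ = C * ∫ q in tsupport φ, ∑ i ∈ Finset.range N,
          h⁻¹ * ‖u (z (i + 1) + h • q) - u (z i + h • q) - v‖ := by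
        rw [← Finset.mul_sum, integral_finsetSum _ hint]
      _ ≤ C * ∫ _ in tsupport φ, N * κ := by
        refine mul_le_mul_of_nonneg_left ?_ hC.le
        refine setIntegral_mono_on (integrable_finsetSum _ hint) ?_
          (isClosed_tsupport φ).measurableSet fun q hq => ?_
        · exact integrableOn_const hφc.measure_lt_top.ne
        · rw [← Finset.mul_sum, inv_mul_le_iff₀ hh]
          refine (hsum q (hφQ hq)).trans (le_of_eq (by ring))
      _ = C * (N * κ * s) := by
        rw [setIntegral_const, smul_eq_mul, hs]
        ring
  have hNpos : (0 : ℝ) < N := by exact_mod_cast hN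
  have hη' : η ≤ C * s * κ := by
    refine le_of_mul_le_mul_left ?_ hNpos
    linarith
  have hκ : 0 ≤ κ := by
    have hne : (0 : 𝔼 d) ∈ unitCube d := fun i => by simp
    have := (Finset.sum_nonneg fun i _ => norm_nonneg _).trans (hsum 0 hne)
    have h2 : 0 < N * h := by positivity
    exact nonneg_of_mul_nonneg_right this h2
  linarith

/-- If the average of vectors `D i` of norm at most `R` is close to a vector of norm at least `a`,
with `a` close to `R`, then most of the `D i` are close to that vector. -/
theorem sum_norm_sub_le {E : Type*} [NormedAddCommGroup E] [InnerProductSpace ℝ E] {N : ℕ}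
    {D : ℕ → E} {v : E} {R a e r : ℝ} (hR : ∀ i < N, ‖D i‖ ≤ R) (ha : 0 ≤ a)
    (hv : a ≤ ‖v‖) (he : ‖∑ i ∈ Finset.range N, D i - (N : ℝ) • v‖ ≤ e) (hr : 0 ≤ r)
    (hle : N * (R ^ 2 - a ^ 2) + 2 * e * ‖v‖ ≤ N * r ^ 2) :
    ∑ i ∈ Finset.range N, ‖D i - v‖ ≤ N * r := by
  have hsq : ∑ i ∈ Finset.range N, ‖D i - v‖ ^ 2 ≤ N * r ^ 2 := by
    have h1 : ∑ i ∈ Finset.range N, ‖D i - v‖ ^ 2 = ∑ i ∈ Finset.range N, ‖D i‖ ^ 2 -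
        2 * inner ℝ (∑ i ∈ Finset.range N, D i - (N : ℝ) • v) v - N * ‖v‖ ^ 2 := by
      simp_rw [norm_sub_sq_real]
      rw [Finset.sum_add_distrib, Finset.sum_sub_distrib, ← Finset.mul_sum, ← sum_inner,
        inner_sub_left, inner_smul_left, real_inner_self_eq_norm_sq]
      simp
      ring
    have h2 : ∑ i ∈ Finset.range N, ‖D i‖ ^ 2 ≤ N * R ^ 2 := by
      calc _ ≤ ∑ i ∈ Finset.range N, R ^ 2 := Finset.sum_le_sum fun i hi =>
            pow_le_pow_left₀ (norm_nonneg _) (hR i (Finset.mem_range.1 hi)) 2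
        _ = _ := by simp
    have h3 := (abs_le.1 (abs_real_inner_le_norm
      (∑ i ∈ Finset.range N, D i - (N : ℝ) • v) v)).1
    have h4 := mul_le_mul_of_nonneg_right he (norm_nonneg v)
    have h5 : (N : ℝ) * a ^ 2 ≤ N * ‖v‖ ^ 2 :=
      mul_le_mul_of_nonneg_left (pow_le_pow_left₀ ha hv 2) (Nat.cast_nonneg N)
    rw [h1]
    linarith
  have hcs := sq_sum_le_card_mul_sum_sq (s := Finset.range N) (f := fun i => ‖D i - v‖)
  rw [Finset.card_range] at hcs
  refine abs_le_of_sq_le_sq' (hcs.trans ?_) (by positivity) |>.2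
  calc (N : ℝ) * ∑ i ∈ Finset.range N, ‖D i - v‖ ^ 2 ≤ N * (N * r ^ 2) :=
        mul_le_mul_of_nonneg_left hsq (Nat.cast_nonneg N)
    _ = (N * r) ^ 2 := by ring

/-- The powers `cos² (π M xᵢ) ^ n` concentrate on hyperplanes as `n → ∞`. -/
theorem exists_integral_cos_sq_pow_lt (i : Fin d) {M : ℝ} (hM : M ≠ 0) {δ : ℝ} (hδ : 0 < δ) :
    ∃ n : ℕ, ∫ x in unitCube d, (Real.cos (Real.pi * (M * x i)) ^ 2) ^ n < δ := by
  have hnull : ∀ᵐ x : 𝔼 d, Real.sin (Real.pi * (M * x i)) ≠ 0 := by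
    have hsub : {x : 𝔼 d | ¬ Real.sin (Real.pi * (M * x i)) ≠ 0} ⊆
        ⋃ n : ℤ, (WithLp.ofLp : (𝔼 d) → Fin d → ℝ) ⁻¹' {y | y i = n / M} := by
      intro x hx
      obtain ⟨n, hn⟩ := Real.sin_eq_zero_iff.1 (not_not.1 hx)
      refine mem_iUnion.2 ⟨n, ?_⟩
      have : (n : ℝ) = M * x i :=
        mul_right_cancel₀ Real.pi_ne_zero (hn.trans (mul_comm _ _))
      change x i = n / M
      rw [this]
      field_simp
    refine measure_mono_null hsub (measure_iUnion_null fun n => ?_)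
    have hplane : volume {y : Fin d → ℝ | y i = n / M} = 0 :=
      Measure.pi_hyperplane (fun _ : Fin d => (volume : Measure ℝ)) i (n / M)
    exact (PiLp.volume_preserving_ofLp (Fin d)).quasiMeasurePreserving.preimage_null
      hplane
  have hlim : Tendsto (fun n : ℕ => ∫ x in unitCube d, (Real.cos (Real.pi * (M * x i)) ^ 2) ^ n)
      atTop (𝓝 (∫ _ in unitCube d, (0 : ℝ))) := by
    refine tendsto_integral_of_dominated_convergence (fun _ => 1) (fun n => ?_) ?_ (fun n => ?_) ?_
    · have : Continuous fun x : 𝔼 d => (Real.cos (Real.pi * (M * x i)) ^ 2) ^ n := by fun_prop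
      exact this.aestronglyMeasurable
    · exact integrableOn_const isCompact_unitCube.measure_lt_top.ne
    · refine Eventually.of_forall fun x => ?_
      rw [Real.norm_of_nonneg (by positivity)]
      exact pow_le_one₀ (sq_nonneg _) (Real.cos_sq_le_one _)
    · filter_upwards [ae_restrict_of_ae hnull] with x hx
      refine tendsto_pow_atTop_nhds_zero_of_lt_one (sq_nonneg _) ?_
      have := Real.sin_sq_add_cos_sq (Real.pi * (M * x i))
      have h2 : 0 < Real.sin (Real.pi * (M * x i)) ^ 2 := by positivity
      linarith
  rw [integral_zero] at hlim
  exact (hlim.eventually_lt_const hδ).exists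

theorem exists_forall_one_sub_le_cos_sq_pow (n : ℕ) {θ : ℝ} (hθ : 0 < θ) :
    ∃ p : ℕ, 0 < p ∧ ∀ s : ℝ, 0 ≤ s → s * (2 * p) ≤ 1 →
      1 - θ ≤ (Real.cos (Real.pi * s) ^ 2) ^ n := by
  have hcont : Continuous fun s : ℝ => (Real.cos (Real.pi * s) ^ 2) ^ n := by fun_prop
  have hev : ∀ᶠ s in 𝓝 (0 : ℝ), 1 - θ < (Real.cos (Real.pi * s) ^ 2) ^ n := by
    refine hcont.continuousAt.eventually_const_lt ?_
    simpa using hθ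
  obtain ⟨r, hr, hball⟩ := Metric.eventually_nhds_iff.1 hev
  obtain ⟨p, hp⟩ := exists_nat_gt (1 / r)
  have hp0 : (0 : ℝ) < p := lt_trans (by positivity) hp
  refine ⟨p, by exact_mod_cast hp0, fun s hs hsp => (hball ?_).le⟩
  rw [Real.dist_eq, sub_zero, abs_of_nonneg hs]
  rw [div_lt_iff₀ hr] at hp
  by_contra! hcon
  nlinarith

/-- The weighted mean over a small cell of a function `L¹`-close to `g` is close to the weighted
mean of a uniform approximation `w` of `g` on that cell. -/
theorem abs_integral_mul_cell_sub_le {φ f g w : (𝔼 d) → ℝ} (hφ : Continuous φ)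
    (hφQ : tsupport φ ⊆ unitCube d) (hφ0 : ∀ x, 0 ≤ φ x) (hφ1 : ∀ x, φ x ≤ 1)
    (hf : Continuous f) (hg : Continuous g) (hw : Continuous w) {z : 𝔼 d} {h ρ : ℝ} (hh : 0 < h)
    (hz : ∀ q ∈ unitCube d, z + h • q ∈ unitCube d)
    (hgw : ∀ q ∈ unitCube d, |g (z + h • q) - w q| ≤ ρ) :
    |(∫ q, φ q * f (z + h • q)) - ∫ q, φ q * w q| ≤
      ρ * volume.real (unitCube d) + (h ^ d)⁻¹ * ∫ x in unitCube d, |f x - g x| := by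
  have hφc : HasCompactSupport φ :=
    isCompact_unitCube.of_isClosed_subset (isClosed_tsupport φ) hφQ
  have hint (F : (𝔼 d) → ℝ) (hF : Continuous F) : Integrable fun q => φ q * F q :=
    (hφ.mul hF).integrable_of_hasCompactSupport hφc.mul_right
  have hfz : Continuous fun q => f (z + h • q) := by fun_prop
  set G : (𝔼 d) → ℝ := (unitCube d).indicator fun x => |f x - g x| with hG
  have hGint : Integrable G := by
    refine (integrable_indicator_iff measurableSet_unitCube).2 ?_
    exact (hf.sub hg).abs.continuousOn.integrableOn_compact isCompact_unitCube
  have hGz : Integrable fun q => G (z + h • q) :=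
    (hGint.comp_add_left z).comp_smul hh.ne'
  have hGval : ∫ q, G (z + h • q) = (h ^ d)⁻¹ * ∫ x in unitCube d, |f x - g x| := by
    rw [Measure.integral_comp_smul volume (fun x => G (z + x)) h, integral_add_left_eq_self,
      finrank_euclideanSpace_fin, abs_of_pos (by positivity), smul_eq_mul, hG,
      integral_indicator measurableSet_unitCube]
  have hQint : Integrable ((unitCube d).indicator fun _ => ρ) :=
    (integrable_indicator_iff measurableSet_unitCube).2
      (integrableOn_const isCompact_unitCube.measure_lt_top.ne)
  have hpt : ∀ q, ‖φ q * f (z + h • q) - φ q * w q‖ ≤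
      (unitCube d).indicator (fun _ => ρ) q + G (z + h • q) := by
    intro q
    by_cases hq : q ∈ unitCube d
    · rw [← mul_sub, norm_mul, Real.norm_of_nonneg (hφ0 q), Real.norm_eq_abs,
        indicator_of_mem hq, hG, indicator_of_mem (hz q hq)]
      refine (mul_le_of_le_one_left (abs_nonneg _) (hφ1 q)).trans ?_
      refine (abs_sub_le _ (g (z + h • q)) _).trans ?_
      linarith [hgw q hq]
    · have h0 : φ q = 0 := image_eq_zero_of_notMem_tsupport fun h' => hq (hφQ h')
      rw [indicator_of_notMem hq, h0]
      simpa using indicator_nonneg (fun _ _ => abs_nonneg _) _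
  rw [← integral_sub (hint _ hfz) (hint _ hw)]
  calc |∫ q, (φ q * f (z + h • q) - φ q * w q)|
      ≤ ∫ q, ((unitCube d).indicator (fun _ => ρ) q + G (z + h • q)) :=
        norm_integral_le_of_norm_le (hQint.add hGz) (Eventually.of_forall hpt)
    _ = ρ * volume.real (unitCube d) + (h ^ d)⁻¹ * ∫ x in unitCube d, |f x - g x| := by
        rw [integral_add hQint hGz, hGval, integral_indicator measurableSet_unitCube,
          setIntegral_const, smul_eq_mul, mul_comm]

theorem EuclideanSpace.norm_le_card_mul {x : 𝔼 d} {c : ℝ} (hx : ∀ i, |x i| ≤ c) :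
    ‖x‖ ≤ d * c := by
  have hsum : x = ∑ i, EuclideanSpace.single i (x i) := by
    ext j
    simp
  calc ‖x‖ = ‖∑ i, EuclideanSpace.single i (x i)‖ := by rw [← hsum]
    _ ≤ ∑ i, ‖EuclideanSpace.single i (x i)‖ := norm_sum_le _ _
    _ ≤ ∑ _i : Fin d, c := Finset.sum_le_sum fun i _ => by simpa using hx i
    _ = d * c := by simp

/-- A point of the lattice `M⁻¹ ℤᵈ` near `x`, shifted slightly towards the origin. -/
theorem exists_lattice_point {x : 𝔼 d} (hx : x ∈ unitCube d) {M : ℝ} (hM : 1 ≤ M) :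
    ∃ n : Fin d → ℕ, ∃ y : 𝔼 d, ∀ j, y j = n j / M ∧ M * y j ≤ (M - 1) * x j ∧
      M * |y j - x j| ≤ 2 := by
  refine ⟨fun j => ⌊(M - 1) * x j⌋₊, WithLp.toLp 2 fun j => ⌊(M - 1) * x j⌋₊ / M, fun j => ?_⟩
  have hM0 : 0 < M := by linarith
  have hxj := hx j
  have h0 : 0 ≤ (M - 1) * x j := mul_nonneg (by linarith) hxj.1
  have h1 := Nat.floor_le h0
  have h2 := Nat.lt_floor_add_one ((M - 1) * x j)
  have h3 : M * ((⌊(M - 1) * x j⌋₊ : ℝ) / M) = ⌊(M - 1) * x j⌋₊ := by field_simp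
  refine ⟨rfl, ?_, ?_⟩
  · change M * ((⌊(M - 1) * x j⌋₊ : ℝ) / M) ≤ _
    rwa [h3]
  · change M * |(⌊(M - 1) * x j⌋₊ : ℝ) / M - x j| ≤ 2
    rw [← abs_of_pos hM0, ← abs_mul, abs_of_pos hM0, mul_sub, h3, abs_le]
    have := hxj.1
    have := hxj.2
    constructor <;> linarith

/-- Smooth functions uniformly within `ε` of the constant `1`. -/
def IsNearOne (ε : ℝ) (f : (𝔼 d) → ℝ) : Prop :=
  ContDiff ℝ (⊤ : ℕ∞) f ∧ ∀ x, |f x - 1| ≤ ε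

/-- Inserting rapid oscillations into `f` on thin slabs around the hyperplanes
`x i₁ ∈ M⁻¹ ℤ`. -/
theorem IsNearOne.exists_perturbation {ε : ℝ} (hε : 0 < ε) (i₀ i₁ : Fin d) {f : (𝔼 d) → ℝ}
    (hf : IsNearOne ε f) {M : ℕ} (hM : 0 < M) {δ ρ : ℝ} (hδ : 0 < δ) (hρ : 0 < ρ) :
    ∃ (p : ℕ) (g : (𝔼 d) → ℝ), 0 < p ∧ IsNearOne ε g ∧ ∫ x in unitCube d, |g x - f x| < δ ∧
      ∀ (x : 𝔼 d) (n : ℕ) (s : ℝ), M * x i₁ = n + s → 0 ≤ s → s * (2 * p) ≤ 1 →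
        |g x - (1 + ε * Real.sin (Real.pi * (M * (2 * p) * x i₀)))| ≤ ρ := by
  have hM' : (M : ℝ) ≠ 0 := by positivity
  obtain ⟨n, hn⟩ := exists_integral_cos_sq_pow_lt i₁ hM' (δ := δ / (2 * ε)) (by positivity)
  obtain ⟨p, hp, hcos⟩ := exists_forall_one_sub_le_cos_sq_pow n (θ := ρ / (2 * ε)) (by positivity)
  set S : (𝔼 d) → ℝ := fun x => 1 + ε * Real.sin (Real.pi * (M * (2 * p) * x i₀)) with hS
  set χ : (𝔼 d) → ℝ := fun x => (Real.cos (Real.pi * (M * x i₁)) ^ 2) ^ n with hχ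
  have hcoord (i : Fin d) : ContDiff ℝ (⊤ : ℕ∞) fun x : 𝔼 d => x i := by fun_prop
  have hSd : ContDiff ℝ (⊤ : ℕ∞) S :=
    contDiff_const.add (contDiff_const.mul (Real.contDiff_sin.comp
      (contDiff_const.mul (contDiff_const.mul (hcoord i₀)))))
  have hχd : ContDiff ℝ (⊤ : ℕ∞) χ :=
    ((Real.contDiff_cos.comp (contDiff_const.mul (contDiff_const.mul (hcoord i₁)))).pow 2).pow n
  have hχ0 (x) : 0 ≤ χ x := by positivity
  have hχ1 (x) : χ x ≤ 1 := pow_le_one₀ (sq_nonneg _) (Real.cos_sq_le_one _)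
  have hS1 (x) : |S x - 1| ≤ ε := by
    simp only [hS, add_sub_cancel_left, abs_mul, abs_of_pos hε]
    exact mul_le_of_le_one_right hε.le (Real.abs_sin_le_one _)
  have hSf (x) : |S x - f x| ≤ 2 * ε := by
    have h1 := abs_le.1 (hS1 x)
    have h2 := abs_le.1 (hf.2 x)
    rw [abs_le]
    constructor <;> linarith
  have hgd : ContDiff ℝ (⊤ : ℕ∞) fun x => f x + χ x * (S x - f x) :=
    hf.1.add (hχd.mul (hSd.sub hf.1))
  refine ⟨p, fun x => f x + χ x * (S x - f x), hp, ⟨hgd, fun x => ?_⟩, ?_, ?_⟩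
  · have h1 := abs_le.1 (hS1 x)
    have h2 := abs_le.1 (hf.2 x)
    have h3 := hχ0 x
    have h4 := hχ1 x
    rw [abs_le]
    constructor <;> nlinarith
  · have hle : ∫ x in unitCube d, |f x + χ x * (S x - f x) - f x| ≤
        ∫ x in unitCube d, 2 * ε * χ x := by
      refine setIntegral_mono_on ?_ ?_ measurableSet_unitCube fun x _ => ?_
      · exact (hgd.continuous.sub hf.1.continuous).abs.continuousOn.integrableOn_compact
          isCompact_unitCube
      · exact (continuous_const.mul hχd.continuous).continuousOn.integrableOn_compact
          isCompact_unitCube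
      · rw [add_sub_cancel_left, abs_mul, abs_of_nonneg (hχ0 x), mul_comm]
        exact mul_le_mul_of_nonneg_right (hSf x) (hχ0 x)
    refine hle.trans_lt ?_
    rw [integral_const_mul]
    rw [lt_div_iff₀ (by positivity)] at hn
    linarith
  · intro x j s hxs hs hsp
    have hχx : 1 - ρ / (2 * ε) ≤ χ x := by
      have := hcos s hs hsp
      simp only [hχ, hxs]
      rwa [mul_add, add_comm, mul_comm Real.pi (j : ℝ), Real.cos_add_nat_mul_pi, mul_pow,
        ← pow_mul, mul_comm j 2, pow_mul, neg_one_sq, one_pow, one_mul]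
    change |f x + χ x * (S x - f x) - S x| ≤ ρ
    have heq : f x + χ x * (S x - f x) - S x = -((1 - χ x) * (S x - f x)) := by ring
    rw [heq, abs_neg, abs_mul, abs_of_nonneg (sub_nonneg.2 (hχ1 x))]
    calc (1 - χ x) * |S x - f x| ≤ ρ / (2 * ε) * (2 * ε) :=
          mul_le_mul (by linarith) (hSf x) (abs_nonneg _) (by positivity)
      _ = ρ := by field_simp

/-- If the increment of `u` along a long segment almost realises the maximal stretch `A + k`, then
the increments along the short segments of a nearby parallel row are mostly close to their mean. -/
theorem IsJacobianSolution.sum_norm_increment_sub_le {L : ℝ} {f : (𝔼 d) → ℝ} {u : (𝔼 d) → 𝔼 d}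
    (hu : IsJacobianSolution L f u) (hL : 0 ≤ L) {e x y : 𝔼 d} (he : ‖e‖ = 1)
    {A k κ h l τ : ℝ} {N : ℕ} (hN : 0 < N) (hh : 0 < h) (hl : N * h = l) (hA : 0 ≤ A)
    (hκ : 0 ≤ κ) (hx : x ∈ unitCube d) (hxl : x + l • e ∈ unitCube d)
    (hstretch : A * l ≤ ‖u (x + l • e) - u x‖)
    (hcell : ∀ i ≤ N, ∀ q ∈ unitCube d, y + (i * h) • e + h • q ∈ unitCube d)
    (hshort : ∀ p ∈ unitCube d, p + h • e ∈ unitCube d → ‖u (p + h • e) - u p‖ ≤ (A + k) * h)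
    (hτ : ∀ q ∈ unitCube d, ‖y + h • q - x‖ ≤ τ)
    (hle : (2 * A * k + k ^ 2) * l + 4 * L ^ 2 * τ ≤ l * κ ^ 2) :
    ∀ q ∈ unitCube d, ∑ i ∈ Finset.range N, ‖u (y + ((i + 1 : ℕ) * h) • e + h • q) -
      u (y + (i * h) • e + h • q) - (N : ℝ)⁻¹ • (u (x + l • e) - u x)‖ ≤ N * h * κ := by
  intro q hq
  have hN' : (0 : ℝ) < N := by exact_mod_cast hN
  have hl0 : 0 < l := hl ▸ mul_pos hN' hh
  have hτ0 : 0 ≤ τ := (norm_nonneg _).trans (hτ q hq)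
  set w : 𝔼 d := u (x + l • e) - u x with hw
  have hnorm : ‖(N : ℝ)⁻¹ • w‖ = (N : ℝ)⁻¹ * ‖w‖ := by
    rw [norm_smul, Real.norm_of_nonneg (inv_nonneg.2 hN'.le)]
  have hwL : ‖w‖ ≤ L * l := by
    have := hu.norm_sub_le hx hxl
    rwa [add_sub_cancel_left, norm_smul, he, Real.norm_of_nonneg hl0.le, mul_one] at this
  have hvL : ‖(N : ℝ)⁻¹ • w‖ ≤ L * h := by
    rw [hnorm, inv_mul_le_iff₀ hN']
    calc ‖w‖ ≤ L * l := hwL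
      _ = N * (L * h) := by rw [← hl]; ring
  rw [mul_assoc]
  refine sum_norm_sub_le (R := (A + k) * h) (a := A * h) (e := 2 * L * τ) (fun i hi => ?_)
    (by positivity) ?_ ?_ (by positivity) ?_
  · have hstep : y + ((i + 1 : ℕ) * h) • e + h • q = y + (i * h) • e + h • q + h • e := by
      push_cast
      module
    have h1 := hcell (i + 1) hi q hq
    rw [hstep] at h1 ⊢
    exact hshort _ (hcell i hi.le q hq) h1
  · rw [hnorm, le_inv_mul_iff₀ hN']
    calc N * (A * h) = A * l := by rw [← hl]; ring
      _ ≤ ‖w‖ := hstretch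
  · rw [Finset.sum_range_sub fun i : ℕ => u (y + (i * h) • e + h • q), smul_smul,
      mul_inv_cancel₀ hN'.ne', one_smul]
    have h0 := hcell 0 (Nat.zero_le N) q hq
    have h1 := hcell N le_rfl q hq
    have e0 : y + ((0 : ℕ) * h) • e + h • q - x = y + h • q - x := by
      push_cast
      module
    have e1 : y + (N * h) • e + h • q - (x + l • e) = y + h • q - x := by
      rw [hl]
      module
    have b0 := hu.norm_sub_le hx h0
    have b1 := hu.norm_sub_le hxl h1
    rw [e0] at b0
    rw [e1] at b1
    have b2 := mul_le_mul_of_nonneg_left (hτ q hq) hL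
    calc _ = ‖(u (y + (N * h) • e + h • q) - u (x + l • e)) -
          (u (y + ((0 : ℕ) * h) • e + h • q) - u x)‖ := by
          rw [hw]
          congr 1
          abel
      _ ≤ _ := _root_.norm_sub_le _ _
      _ ≤ 2 * L * τ := by linarith
  · have h1 : 2 * (2 * L * τ) * ‖(N : ℝ)⁻¹ • w‖ ≤ 2 * (2 * L * τ) * (L * h) :=
      mul_le_mul_of_nonneg_left hvL (by positivity)
    have h2 := mul_le_mul_of_nonneg_right hle hh.le
    rw [← hl] at h2
    calc _ ≤ N * (((A + k) * h) ^ 2 - (A * h) ^ 2) + 2 * (2 * L * τ) * (L * h) := by linarith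
      _ = ((2 * A * k + k ^ 2) * (N * h) + 4 * L ^ 2 * τ) * h := by ring
      _ ≤ N * h * κ ^ 2 * h := h2
      _ = N * (h * κ) ^ 2 := by ring

/-- Some target density, and every density `L¹`-close to it, forces every solution with derivative
bounded by `L` to stretch a segment of length `1 / m` in direction `i₀` at least by the
factor `A`. -/
def ForcesStretch (i₀ : Fin d) (L ε A : ℝ) : Prop :=
  ∃ (f : (𝔼 d) → ℝ) (δ : ℝ) (m : ℕ), IsNearOne ε f ∧ 0 < δ ∧ 2 ≤ m ∧
    ∀ f', IsNearOne ε f' → ∫ x in unitCube d, |f' x - f x| < δ →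
      ∀ u, IsJacobianSolution L f' u → ∃ x ∈ unitCube d,
        x + (m : ℝ)⁻¹ • EuclideanSpace.single i₀ (1 : ℝ) ∈ unitCube d ∧
        A * (m : ℝ)⁻¹ ≤ ‖u (x + (m : ℝ)⁻¹ • EuclideanSpace.single i₀ (1 : ℝ)) - u x‖

theorem forcesStretch_zero (i₀ : Fin d) (L : ℝ) {ε : ℝ} (hε : 0 < ε) :
    ForcesStretch i₀ L ε 0 := by
  refine ⟨fun _ => 1, 1, 2, ⟨contDiff_const, fun x => by simpa using hε.le⟩, one_pos, le_rfl,
    fun f' _ _ u _ => ⟨0, fun i => by simp, fun i => ?_, by simp⟩⟩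
  by_cases hi : i = i₀
  · subst hi
    norm_num
  · simp [hi]

/-- On consecutive cells, the oscillation frequency of `1 + ε sin` produces opposite signs, so
densities close to it have different weighted means on these cells. -/
theorem le_abs_integral_mul_sub {φ f g : (𝔼 d) → ℝ} (hφ : Continuous φ)
    (hφQ : tsupport φ ⊆ unitCube d) (hφ0 : ∀ x, 0 ≤ φ x) (hφ1 : ∀ x, φ x ≤ 1)
    (hf : Continuous f) (hg : Continuous g) {i₀ : Fin d} {ε ρ b h δ : ℝ}
    (hb : b = ∫ q, φ q * Real.sin (Real.pi * q i₀)) (hh : 0 < h) {z z' : 𝔼 d} {i : ℕ}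
    (hz : ∀ q ∈ unitCube d, z + h • q ∈ unitCube d)
    (hz' : ∀ q ∈ unitCube d, z' + h • q ∈ unitCube d)
    (hgz : ∀ q ∈ unitCube d,
      |g (z + h • q) - (1 + (-1) ^ i * ε * Real.sin (Real.pi * q i₀))| ≤ ρ)
    (hgz' : ∀ q ∈ unitCube d,
      |g (z' + h • q) - (1 + (-1) ^ (i + 1) * ε * Real.sin (Real.pi * q i₀))| ≤ ρ)
    (hδ : ∫ x in unitCube d, |f x - g x| ≤ δ) :
    2 * (ε * b) - 2 * (ρ * volume.real (unitCube d) + (h ^ d)⁻¹ * δ) ≤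
      |∫ q, φ q * (f (z' + h • q) - f (z + h • q))| := by
  have hφc : HasCompactSupport φ :=
    isCompact_unitCube.of_isClosed_subset (isClosed_tsupport φ) hφQ
  have hint (F : (𝔼 d) → ℝ) (hF : Continuous F) : Integrable fun q => φ q * F q :=
    (hφ.mul hF).integrable_of_hasCompactSupport hφc.mul_right
  have hmean (c : ℝ) : ∫ q, φ q * (1 + c * ε * Real.sin (Real.pi * q i₀)) =
      (∫ q, φ q * 1) + c * (ε * b) := by
    rw [hb, ← integral_const_mul, ← integral_const_mul, ← integral_add (hint _ continuous_const)]
    · congr 1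
      ext q
      ring
    · exact ((hint (fun q => Real.sin (Real.pi * q i₀)) (by fun_prop)).const_mul ε).const_mul c
  have hδ' : (h ^ d)⁻¹ * ∫ x in unitCube d, |f x - g x| ≤ (h ^ d)⁻¹ * δ :=
    mul_le_mul_of_nonneg_left hδ (by positivity)
  have h1 := abs_integral_mul_cell_sub_le hφ hφQ hφ0 hφ1 hf hg (by fun_prop) hh hz hgz
  have h2 := abs_integral_mul_cell_sub_le hφ hφQ hφ0 hφ1 hf hg (by fun_prop) hh hz' hgz'
  rw [hmean] at h1 h2
  have hsplit : ∫ q, φ q * (f (z' + h • q) - f (z + h • q)) =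
      (∫ q, φ q * f (z' + h • q)) - ∫ q, φ q * f (z + h • q) := by
    rw [← integral_sub (hint _ (by fun_prop)) (hint _ (by fun_prop))]
    simp_rw [mul_sub]
  rw [hsplit]
  rw [abs_le] at h1 h2
  rcases neg_one_pow_eq_or ℝ i with hi | hi
  · rw [pow_succ, hi] at h2
    rw [hi] at h1
    refine le_trans ?_ (neg_le_abs _)
    linarith [h1.1, h2.2]
  · rw [pow_succ, hi] at h2
    rw [hi] at h1
    refine le_trans ?_ (le_abs_self _)
    linarith [h1.2, h2.1]

theorem add_smul_single_add_smul_apply (i₀ j : Fin d) (y q : 𝔼 d) (t h : ℝ) :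
    (y + t • EuclideanSpace.single i₀ (1 : ℝ) + h • q) j =
      y j + (if j = i₀ then t else 0) + h * q j := by
  simp

set_option maxHeartbeats 400000 in
/-- The forced stretch can always be increased by a fixed amount. -/
theorem ForcesStretch.exists_increment {i₀ i₁ : Fin d} (hi : i₁ ≠ i₀) {L ε : ℝ} (hL : 0 < L)
    (hε : 0 < ε) : ∃ k : ℝ, 0 < k ∧ ∀ A : ℝ, 0 ≤ A → A ≤ L →
      ForcesStretch i₀ L ε A → ForcesStretch i₀ L ε (A + k) := by
  obtain ⟨φ, χ, hφ, hφc, hχ, hχc, hφχ, hφQ, hχQ, hφ0, hφ1, hbpos⟩ := exists_nested_bumps i₀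
  obtain ⟨C, hC, hosc⟩ := exists_oscillation_le i₀.pos.ne' hφ hφc hχ hχc hφχ hφQ hχQ L
  obtain ⟨b, hb⟩ : ∃ b, b = ∫ x, φ x * Real.sin (Real.pi * x i₀) := ⟨_, rfl⟩
  rw [← hb] at hbpos
  obtain ⟨κ, hκC, hκ⟩ : ∃ κ : ℝ, C * κ = ε * b / 2 ∧ 0 < κ :=
    ⟨ε * b / (2 * C), by field_simp, by positivity⟩
  obtain ⟨k, hk, hk1, hkκ⟩ : ∃ k : ℝ, 0 < k ∧ k ≤ 1 ∧ (2 * L + 1) * k ≤ κ ^ 2 / 2 := by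
    refine ⟨min 1 (κ ^ 2 / (2 * (2 * L + 1))), by positivity, min_le_left _ _, ?_⟩
    calc (2 * L + 1) * min 1 (κ ^ 2 / (2 * (2 * L + 1)))
        ≤ (2 * L + 1) * (κ ^ 2 / (2 * (2 * L + 1))) :=
          mul_le_mul_of_nonneg_left (min_le_right _ _) (by positivity)
      _ = κ ^ 2 / 2 := by field_simp
  refine ⟨k, hk, ?_⟩
  rintro A hA hAL ⟨f, δ, m, hf, hδ, hm, H⟩
  obtain ⟨r, hr⟩ := exists_nat_gt (24 * L ^ 2 * d / κ ^ 2)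
  have hr0 : (0 : ℝ) < r := lt_of_le_of_lt (by positivity) hr
  rw [div_lt_iff₀ (by positivity)] at hr
  have hrN : 0 < r := by exact_mod_cast hr0
  have hmR : (2 : ℝ) ≤ m := by exact_mod_cast hm
  set V : ℝ := volume.real (unitCube d) with hV
  have hV0 : 0 ≤ V := measureReal_nonneg
  obtain ⟨ρ, hρ, hρV⟩ : ∃ ρ : ℝ, 0 < ρ ∧ ρ * V ≤ ε * b / 8 := by
    refine ⟨ε * b / (8 * (V + 1)), by positivity, ?_⟩
    rw [div_mul_eq_mul_div, div_le_div_iff₀ (by positivity) (by positivity)]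
    nlinarith [mul_pos hε hbpos]
  obtain ⟨p, g, hp, hg, hgf, hgs⟩ :=
    hf.exists_perturbation hε i₀ i₁ (M := m * r) (by positivity) (half_pos hδ) hρ
  have hpR : (1 : ℝ) ≤ p := by exact_mod_cast hp
  obtain ⟨M, hM⟩ : ∃ M : ℝ, M = m * r := ⟨_, rfl⟩
  have hrR : (1 : ℝ) ≤ r := by exact_mod_cast hrN
  have hM1 : 1 ≤ M := hM ▸ one_le_mul_of_one_le_of_one_le (by linarith) hrR
  have hM0 : 0 < M := by linarith
  push_cast at hgs
  rw [← hM] at hgs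
  obtain ⟨l, hl⟩ : ∃ l : ℝ, l = (m : ℝ)⁻¹ := ⟨_, rfl⟩
  have hl0 : 0 < l := hl ▸ by positivity
  have hl2 : l ≤ 1 / 2 := by
    rw [hl, inv_le_comm₀ (by linarith) (by norm_num)]
    norm_num
    exact hm
  obtain ⟨h, hh⟩ : ∃ h : ℝ, h = ((m * r * (2 * p) : ℕ) : ℝ)⁻¹ := ⟨_, rfl⟩
  have hh0 : 0 < h := hh ▸ by positivity
  have hMp : M * (2 * p) * h = 1 := by
    rw [hh, hM]
    push_cast
    exact mul_inv_cancel₀ (by positivity)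
  have hNh : ((r * (2 * p) : ℕ) : ℝ) * h = l := by
    rw [hh, hl]
    push_cast
    field_simp
  have hMh : M * h ≤ 1 / 2 := by nlinarith [mul_pos hM0 hh0]
  refine ⟨g, min (δ / 2) (ε * b * h ^ d / 8), m * r * (2 * p), hg, by positivity, ?_,
    fun f' hf' hfg u hu => ?_⟩
  · calc 2 ≤ 1 * 1 * (2 * 1) := by norm_num
      _ ≤ m * r * (2 * p) := by gcongr <;> omega
  have hff : ∫ x in unitCube d, |f' x - f x| < δ := by
    have hint (F G : (𝔼 d) → ℝ) (hF : Continuous F) (hG : Continuous G) :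
        IntegrableOn (fun x => |F x - G x|) (unitCube d) :=
      (hF.sub hG).abs.continuousOn.integrableOn_compact isCompact_unitCube
    have i1 := hint f' g hf'.1.continuous hg.1.continuous
    have i2 := hint g f hg.1.continuous hf.1.continuous
    calc ∫ x in unitCube d, |f' x - f x|
        ≤ ∫ x in unitCube d, (|f' x - g x| + |g x - f x|) :=
          setIntegral_mono (hint f' f hf'.1.continuous hf.1.continuous) (i1.add i2)
            fun x => abs_sub_le _ _ _
      _ = _ := integral_add i1 i2
      _ < δ := by linarith [hfg.trans_le (min_le_left _ _)]
  obtain ⟨x, hx, hxm, hstretch⟩ := H f' hf' hff u hu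
  by_contra! hcon
  rw [← hh] at hcon
  rw [← hl] at hxm hstretch
  obtain ⟨n, y, hy⟩ := exists_lattice_point hx hM1
  have hyn (j : Fin d) : M * y j = n j := by
    rw [(hy j).1]
    field_simp
  have hxl : x i₀ ≤ 1 - l := by
    have := (hxm i₀).2
    simp at this
    linarith
  have hcell : ∀ i ≤ r * (2 * p), ∀ q ∈ unitCube d,
      y + (i * h) • EuclideanSpace.single i₀ (1 : ℝ) + h • q ∈ unitCube d := by
    intro i hiN q hq j
    rw [add_smul_single_add_smul_apply]
    have hy0 : 0 ≤ y j := by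
      rw [(hy j).1]
      positivity
    have hq0 : 0 ≤ h * q j := mul_nonneg hh0.le (hq j).1
    have hqh : M * (h * q j) ≤ 1 / 2 := by
      have := mul_le_mul_of_nonneg_left (mul_le_of_le_one_right hh0.le (hq j).2) hM0.le
      linarith
    have hyM := (hy j).2.1
    have hih : (i : ℝ) * h ≤ l := by
      rw [← hNh]
      exact mul_le_mul_of_nonneg_right (by exact_mod_cast hiN) hh0.le
    split_ifs with hj
    · subst hj
      refine ⟨by positivity, ?_⟩
      refine le_of_mul_le_mul_left ?_ hM0
      have h1 := mul_le_mul_of_nonneg_left hih hM0.le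
      have h2 := mul_le_mul_of_nonneg_left hxl (sub_nonneg.2 hM1)
      linarith
    · refine ⟨by positivity, ?_⟩
      refine le_of_mul_le_mul_left ?_ hM0
      have h2 := mul_le_mul_of_nonneg_left (hx j).2 (sub_nonneg.2 hM1)
      linarith
  have hτ : ∀ q ∈ unitCube d, ‖y + h • q - x‖ ≤ d * (3 / M) := by
    intro q hq
    refine EuclideanSpace.norm_le_card_mul fun j => ?_
    rw [le_div_iff₀ hM0, mul_comm]
    have h1 : (y + h • q - x) j = (y j - x j) + h * q j := by
      simp
      ring
    have hqh : |h * q j| ≤ h := by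
      rw [abs_of_nonneg (mul_nonneg hh0.le (hq j).1)]
      exact mul_le_of_le_one_right hh0.le (hq j).2
    rw [h1]
    calc M * |y j - x j + h * q j| ≤ M * (|y j - x j| + |h * q j|) :=
          mul_le_mul_of_nonneg_left (abs_add_le _ _) hM0.le
      _ ≤ 3 := by linarith [(hy j).2.2, mul_le_mul_of_nonneg_left hqh hM0.le]
  have hMl : M * l = r := by
    rw [hM, hl]
    field_simp
  have hle : (2 * A * k + k ^ 2) * l + 4 * L ^ 2 * (d * (3 / M)) ≤ l * κ ^ 2 := by
    have h1 : 2 * A * k + k ^ 2 ≤ κ ^ 2 / 2 := by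
      linarith [mul_le_mul_of_nonneg_right hAL hk.le, mul_le_mul_of_nonneg_right hk1 hk.le]
    have h2 : 4 * L ^ 2 * (d * (3 / M)) ≤ l * (κ ^ 2 / 2) := by
      have : 4 * L ^ 2 * (d * (3 / M)) = 12 * L ^ 2 * d / M := by ring
      rw [this, div_le_iff₀ hM0]
      calc 12 * L ^ 2 * d ≤ r * (κ ^ 2 / 2) := by linarith
        _ = l * (κ ^ 2 / 2) * M := by rw [← hMl]; ring
    linarith [mul_le_mul_of_nonneg_right h1 hl0.le]
  have hrow := hu.sum_norm_increment_sub_le hL.le (by simp) (by positivity) hh0 hNh hA hκ.le hx hxm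
    hstretch hcell (fun q hq hqe => (hcon q hq hqe).le) hτ hle
  have hphase : ∀ i ≤ r * (2 * p), ∀ q ∈ unitCube d,
      |g (y + (i * h) • EuclideanSpace.single i₀ (1 : ℝ) + h • q) -
        (1 + (-1) ^ i * ε * Real.sin (Real.pi * q i₀))| ≤ ρ := by
    intro i _ q hq
    have key := hgs (y + (i * h) • EuclideanSpace.single i₀ (1 : ℝ) + h • q) (n i₁)
      (M * h * q i₁) ?_ (mul_nonneg (by positivity) (hq i₁).1) ?_
    · convert key using 4
      rw [add_smul_single_add_smul_apply, if_pos rfl]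
      have harg : Real.pi * (M * (2 * p) * (y i₀ + i * h + h * q i₀)) =
          Real.pi * q i₀ + i * Real.pi + (p * n i₀ : ℕ) * (2 * Real.pi) := by
        have : M * (2 * p) * (y i₀ + i * h + h * q i₀) =
            2 * p * (M * y i₀) + (i + q i₀) * (M * (2 * p) * h) := by ring
        rw [this, hyn, hMp]
        push_cast
        ring
      rw [harg, Real.sin_add_nat_mul_two_pi, Real.sin_add_nat_mul_pi]
      ring
    · rw [add_smul_single_add_smul_apply, if_neg hi, ← hyn]
      ring
    · calc M * h * q i₁ * (2 * p) = M * (2 * p) * h * q i₁ := by ring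
        _ ≤ 1 := by rw [hMp, one_mul]; exact (hq i₁).2
  have hlower : ∀ i < r * (2 * p), ε * b ≤ |∫ q, φ q *
      (f' (y + ((i + 1 : ℕ) * h) • EuclideanSpace.single i₀ (1 : ℝ) + h • q) -
        f' (y + (i * h) • EuclideanSpace.single i₀ (1 : ℝ) + h • q))| := by
    intro i hiN
    refine le_trans ?_ (le_abs_integral_mul_sub hφ.continuous hφQ hφ0 hφ1 hf'.1.continuous
      hg.1.continuous hb hh0 (hcell i hiN.le) (hcell (i + 1) hiN) (hphase i hiN.le)
      (hphase (i + 1) hiN) (hfg.le.trans (min_le_right _ _)))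
    have : (h ^ d)⁻¹ * (ε * b * h ^ d / 8) = ε * b / 8 := by field_simp
    rw [this]
    linarith [mul_pos hε hbpos]
  have := hosc f' u hu (r * (2 * p)) h κ (ε * b)
    (fun i => y + (i * h) • EuclideanSpace.single i₀ (1 : ℝ)) _ (by positivity) hh0 hcell hrow
    hlower
  rw [hκC] at this
  linarith [mul_pos hε hbpos]

theorem ForcesStretch.le {i₀ : Fin d} {L ε A : ℝ} (h : ForcesStretch i₀ L ε A)
    (hsol : ∀ f : (𝔼 d) → ℝ, IsNearOne ε f → ∃ u, IsJacobianSolution L f u) : A ≤ L := by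
  obtain ⟨f, δ, m, hf, hδ, hm, H⟩ := h
  obtain ⟨u, hu⟩ := hsol f hf
  obtain ⟨x, hx, hxm, hA⟩ := H f hf (by simpa using hδ) u hu
  have hm0 : (0 : ℝ) < (m : ℝ)⁻¹ := by positivity
  have := hA.trans (hu.norm_sub_le hx hxm)
  rw [add_sub_cancel_left, norm_smul, Real.norm_of_nonneg hm0.le, PiLp.norm_single,
    norm_one, mul_one] at this
  exact le_of_mul_le_mul_right this hm0

/-- No uniform derivative bound holds for solutions of the prescribed Jacobian equation with
smooth data near `1`. -/
theorem not_forall_exists_isJacobianSolution (hd : 2 ≤ d) {L ε : ℝ} (hL : 0 < L) (hε : 0 < ε) :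
    ¬ ∀ f : (𝔼 d) → ℝ, IsNearOne ε f → ∃ u, IsJacobianSolution L f u := by
  intro hsol
  have hi : (⟨1, hd⟩ : Fin d) ≠ ⟨0, by omega⟩ := by simp
  obtain ⟨k, hk, hstep⟩ := ForcesStretch.exists_increment hi hL hε
  have hall (n : ℕ) : ForcesStretch (⟨0, by omega⟩ : Fin d) L ε (n * k) := by
    induction n with
    | zero => simpa using forcesStretch_zero _ L hε
    | succ n ih =>
      have := hstep _ (by positivity) (ih.le hsol) ih
      rwa [Nat.cast_succ, add_one_mul]
  obtain ⟨n, hn⟩ := exists_nat_gt (L / k)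
  rw [div_lt_iff₀ hk] at hn
  linarith [(hall n).le hsol]

theorem c0Norm_le {g : (𝔼 d) → ℝ} {c : ℝ} (hg : ∀ x, |g x| ≤ c) : c0Norm g ≤ c := by
  refine csSup_le ?_ ?_
  · exact ⟨_, 0, fun i => by simp, rfl⟩
  · rintro _ ⟨x, -, rfl⟩
    exact hg x

theorem norm_fderiv_le_c1Norm {u : (𝔼 d) → 𝔼 d} {O : Set (𝔼 d)} (hO : IsOpen O)
    (hQ : unitCube d ⊆ O) (hu : ContDiffOn ℝ 1 u O) {x : 𝔼 d} (hx : x ∈ unitCube d) :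
    ‖fderiv ℝ u x‖ ≤ c1Norm u := by
  have hcont : ContinuousOn (fun x => ‖u x‖ + ‖fderiv ℝ u x‖) (unitCube d) :=
    (hu.continuousOn.norm.add (hu.continuousOn_fderiv_of_isOpen hO le_rfl).norm).mono hQ
  have := le_csSup (isCompact_unitCube.image_of_continuousOn hcont).bddAbove
    (mem_image_of_mem _ hx)
  exact (le_add_of_nonneg_left (norm_nonneg _)).trans this

/-- No bounded right inverse for the Jacobian determinant equation: there is no map 𝓛,
defined on smooth functions f with ‖f − 1‖_{C⁰} ≤ ε, producing C¹ solutions of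
det D(𝓛f) = f on the cube with ‖𝓛f‖_{C¹} ≤ K‖f‖_{C⁰}. -/
theorem no_bounded_right_inverse_jacobian (d : ℕ) (hd : 2 ≤ d)
    (K : ℝ) (hK : 0 < K) (ε : ℝ) (hε : 0 < ε) :
    ¬ ∃ 𝓛 : (EuclideanSpace ℝ (Fin d) → ℝ) →
        (EuclideanSpace ℝ (Fin d) → EuclideanSpace ℝ (Fin d)),
      ∀ f, ContDiff ℝ (⊤ : ℕ∞) f → c0Norm (fun x => f x - 1) ≤ ε →
        (∃ O, IsOpen O ∧ unitCube d ⊆ O ∧ ContDiffOn ℝ 1 (𝓛 f) O) ∧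
        (∀ x ∈ unitCube d, LinearMap.det (fderiv ℝ (𝓛 f) x).toLinearMap = f x) ∧
        c1Norm (𝓛 f) ≤ K * c0Norm f := by
  rintro ⟨𝓛, h𝓛⟩
  refine not_forall_exists_isJacobianSolution hd (L := K * (1 + ε)) (by positivity) hε ?_
  intro f hf
  obtain ⟨⟨O, hO, hQ, hcd⟩, hdet, hnorm⟩ := h𝓛 f hf.1 (c0Norm_le hf.2)
  refine ⟨𝓛 f, ⟨O, hO, hQ, hcd⟩, hdet, fun x hx => ?_⟩
  refine (norm_fderiv_le_c1Norm hO hQ hcd hx).trans (hnorm.trans ?_)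
  refine mul_le_mul_of_nonneg_left (c0Norm_le fun x => ?_) hK.le
  have := abs_le.1 (hf.2 x)
  rw [abs_le]
  constructor <;> linarith
end
end
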